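/- Under assumptions (H1), (H2) and (H3), for every m̄₀ ∈ L^∞(ℝ^d) ∩ P₂(ℝ^d), there exists an (F_t)-adapted process m̃ ∈ S^r(P₁(ℝ^d)) ∩ L^∞(ℝ^d×(0,T)) which, ℙ-a.s., solves in the sense of distributions the continuity equation ∂_t m̃_t = div(m̃_t D_pH̃_t(Dũ_t(x),x)) on ℝ^d×(0,T) with m̃_0 = m̄₀, where ũ is the solution of the backward stochastic Hamilton–Jacobi equation. -/

import Mathlib

open MeasureTheory ProbabilityTheory Filter Set
open scoped ENNReal NNReal Topology RealInnerProductSpace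

noncomputable section

variable (d : ℕ) {Ω : Type*} [mΩ : MeasurableSpace Ω]

local notation "V" => EuclideanSpace ℝ (Fin d)

/-- `f` is semiconcave with constant `C`
(equivalent to `D²f z·z ≤ C` for `|z| ≤ 1` in the sense of distributions). -/
def SemiconcaveWith (C : ℝ) (f : V → ℝ) : Prop :=
  ∀ x y : V, ∀ θ : ℝ, 0 ≤ θ → θ ≤ 1 →
    θ * f x + (1 - θ) * f y - f (θ • x + (1 - θ) • y) ≤ C / 2 * (θ * (1 - θ)) * ‖x - y‖ ^ 2

/-- `W` is a `d`-dimensional Wiener process adapted to the filtration `F`, with increments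
independent of the past and Gaussian increments. -/
def IsWienerProcess (μ : Measure Ω) (F : Filtration ℝ mΩ) (W : ℝ → Ω → V) : Prop :=
  (∀ᵐ ω ∂μ, W 0 ω = 0) ∧
  (∀ᵐ ω ∂μ, Continuous fun t => W t ω) ∧
  Adapted F W ∧
  (∀ s t : ℝ, 0 ≤ s → s ≤ t →
    Indep (F s) (MeasurableSpace.comap (fun ω => W t ω - W s ω) inferInstance) μ) ∧
  (∀ s t : ℝ, 0 ≤ s → s ≤ t → ∀ v : V,
    Measure.map (fun ω => ⟪v, W t ω - W s ω⟫) μ =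
      gaussianReal 0 (Real.toNNReal ((t - s) * ‖v‖ ^ 2)))

/-- Assumption (H1): `G̃ ∈ L^∞(Ω, F_T, C²(ℝ^d))` and `H̃` is an adapted process of
locally `C²` functions. -/
def H1Hyp (μ : Measure Ω) (F : Filtration ℝ mΩ) (T : ℝ)
    (H : ℝ → V → V → Ω → ℝ) (G : V → Ω → ℝ) : Prop :=
  (∃ C : ℝ, 0 < C ∧ ∀ ω : Ω, ContDiff ℝ 2 (fun x : V => G x ω) ∧ ∀ x : V,
      |G x ω| + ‖fderiv ℝ (fun y : V => G y ω) x‖ +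
        ‖iteratedFDeriv ℝ 2 (fun y : V => G y ω) x‖ ≤ C) ∧
  (∀ x : V, StronglyMeasurable[F T] fun ω => G x ω) ∧
  (∀ ω : Ω, ∀ t : ℝ, ContDiff ℝ 2 fun q : V × V => H t q.1 q.2 ω) ∧
  (∀ p x : V, Adapted F fun t ω => H t p x ω) ∧
  (∀ p x : V, ∀ ω : Ω, Continuous fun t => H t p x ω)

/-- Assumption (H2): the Hamiltonian satisfies condition (HH) uniformly in `t ∈ [0,T]`, `ω`. -/
def H2Hyp (T : ℝ) (H : ℝ → V → V → Ω → ℝ) : Prop :=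
  (∀ t ∈ Icc (0:ℝ) T, ∀ ω : Ω, ∀ x : V, ConvexOn ℝ univ fun p : V => H t p x ω) ∧
  (∀ R : ℝ, 0 < R → ∃ C : ℝ, 0 < C ∧ ∀ t ∈ Icc (0:ℝ) T, ∀ ω : Ω, ∀ p x : V, ‖p‖ ≤ R →
      |H t p x ω| + ‖fderiv ℝ (fun q : V => H t q x ω) p‖ +
        ‖fderiv ℝ (fun y : V => fderiv ℝ (fun q : V => H t q y ω) p) x‖ +
        ‖iteratedFDeriv ℝ 2 (fun q : V => H t q x ω) p‖ ≤ C) ∧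
  (∃ lam C₀ : ℝ, 0 < lam ∧ 0 < C₀ ∧ ∀ t ∈ Icc (0:ℝ) T, ∀ ω : Ω, ∀ p q x z : V, ‖z‖ = 1 →
      lam * (fderiv ℝ (fun q' : V => H t q' x ω) p p - H t p x ω) +
        iteratedFDeriv ℝ 2 (fun r : V × V => H t r.1 r.2 ω) (p, x) ![(q, z), (q, z)]
        ≥ -C₀)

/-- Assumption (H3): the expected time modulus of continuity of `H̃` on bounded gradient
sets tends to `0`. -/
def H3Hyp (μ : Measure Ω) (T : ℝ) (H : ℝ → V → V → Ω → ℝ) : Prop :=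
  ∀ R : ℝ, 0 < R → ∃ w : ℕ → Ω → ℝ,
    (∀ N : ℕ, ∀ ω : Ω, ∀ s ∈ Icc (0:ℝ) T, ∀ t ∈ Icc (0:ℝ) T, |s - t| ≤ 1 / N →
      ∀ p y : V, ‖p‖ ≤ R → |H s p y ω - H t p y ω| ≤ w N ω) ∧
    Tendsto (fun N : ℕ => ∫ ω, w N ω ∂μ) atTop (𝓝 0)

/-- Regularity part of the definition of a solution of the backward stochastic HJ
equation: adaptedness, time continuity, uniform bounds, Lipschitz bounds and
semiconcavity in space, and the martingale property of `M`. -/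
structure HJReg (μ : Measure Ω) (F : Filtration ℝ mΩ) (T : ℝ)
    (u M : ℝ → V → Ω → ℝ) : Prop where
  adapted_u : ∀ x : V, Adapted F fun t ω => u t x ω
  adapted_M : ∀ x : V, Adapted F fun t ω => M t x ω
  cont_u : ∀ᵐ ω ∂μ, ∀ x : V, ContinuousOn (fun t => u t x ω) (Icc 0 T)
  bdd : ∃ C : ℝ, 0 < C ∧ ∀ᵐ ω ∂μ, ∀ᵐ t ∂(volume.restrict (Icc (0:ℝ) T)),
      (∀ x : V, |u t x ω| ≤ C ∧ |M t x ω| ≤ C) ∧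
      LipschitzWith C.toNNReal (fun x : V => u t x ω) ∧
      SemiconcaveWith d C fun x : V => u t x ω
  mart : ∀ᵐ x ∂(volume : Measure V),
      Martingale (fun t ω => M t x ω) F μ ∧ ∀ᵐ ω ∂μ, Continuous fun t => M t x ω

/-- A solution of the backward stochastic HJ equation
`d u_t = H̃_t(Du_t, x) dt + dM̃_t`, `u_T = G̃`. -/
def IsHJSol (μ : Measure Ω) (F : Filtration ℝ mΩ) (T : ℝ)
    (H : ℝ → V → V → Ω → ℝ) (G : V → Ω → ℝ) (u M : ℝ → V → Ω → ℝ) : Prop :=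
  HJReg d μ F T u M ∧
  ∀ᵐ q ∂((volume : Measure V).prod (volume.restrict (Icc (0:ℝ) T))), ∀ᵐ ω ∂μ,
    u q.2 q.1 ω = G q.1 ω
      - (∫ s in Ioc q.2 T, H s (gradient (fun y : V => u s y ω) q.1) q.1 ω)
      - M T q.1 ω + M q.2 q.1 ω

/-- `ρ0` is a probability density on `ℝ^d`. -/
def IsProbDensity (ρ0 : V → ℝ) : Prop :=
  Measurable ρ0 ∧ (∀ x, 0 ≤ ρ0 x) ∧ (∫ x : V, ρ0 x) = 1

/-- The process of densities `ρ` is an adapted solution, `ℙ`-a.s. and in the sense of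
distributions, of the continuity equation `∂_t m_t = div(m_t b_t)` on `ℝ^d × (0,T)` with
`m_0 = ρ0·dx`; the process takes values in `P₁(ℝ^d)`, is bounded on `ℝ^d × (0,T)`
and is continuous in time. -/
structure IsContEqSol (μ : Measure Ω) (F : Filtration ℝ mΩ) (T : ℝ)
    (b : ℝ → V → Ω → V) (ρ0 : V → ℝ) (ρ : ℝ → V → Ω → ℝ) : Prop where
  nonneg : ∀ t ∈ Icc (0:ℝ) T, ∀ᵐ ω ∂μ, ∀ᵐ x ∂(volume : Measure V), 0 ≤ ρ t x ω
  bddAbove : ∃ C : ℝ, 0 < C ∧ ∀ t ∈ Icc (0:ℝ) T, ∀ᵐ ω ∂μ,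
      ∀ᵐ x ∂(volume : Measure V), ρ t x ω ≤ C
  prob : ∀ t ∈ Icc (0:ℝ) T, ∀ᵐ ω ∂μ, (∫ x : V, ρ t x ω) = 1
  moment : ∀ t ∈ Icc (0:ℝ) T, ∀ᵐ ω ∂μ, Integrable (fun x : V => ‖x‖ * ρ t x ω)
  adapted : ∀ t ∈ Icc (0:ℝ) T, ∀ φ : V → ℝ, Continuous φ → (∃ K : ℝ, ∀ x, |φ x| ≤ K) →
      StronglyMeasurable[F t] fun ω => ∫ x : V, φ x * ρ t x ω
  timeCont : ∀ᵐ ω ∂μ, ∀ φ : V → ℝ, Continuous φ → (∃ K : ℝ, ∀ x, |φ x| ≤ K) →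
      ContinuousOn (fun t => ∫ x : V, φ x * ρ t x ω) (Icc (0:ℝ) T)
  weakEq : ∀ᵐ ω ∂μ, ∀ φ : V → ℝ, ContDiff ℝ (⊤ : ℕ∞) φ → HasCompactSupport φ →
      ∀ t ∈ Icc (0:ℝ) T,
        (∫ x : V, φ x * ρ t x ω) = (∫ x : V, φ x * ρ0 x)
          - ∫ s in Ioc (0:ℝ) t, ∫ x : V, ⟪gradient φ x, b s x ω⟫ * ρ s x ω

section

variable {d}

lemma aux_first_order {C : ℝ} {f : V → ℝ} (hf : SemiconcaveWith d C f) {x : V} {f' : V →L[ℝ] ℝ}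
    (hx : HasFDerivAt f f' x) (y : V) :
    f y ≤ f x + f' (y - x) + C / 2 * ‖y - x‖ ^ 2 := by
  have hline : HasDerivAt (fun θ : ℝ => f (x + θ • (y - x))) (f' (y - x)) 0 := by
    have h1 : HasDerivAt (fun θ : ℝ => x + θ • (y - x)) (y - x) 0 := by
      simpa using ((hasDerivAt_id (0:ℝ)).smul_const (y - x)).const_add x
    have h2 : HasFDerivAt f f' (x + (0:ℝ) • (y - x)) := by simpa using hx
    exact h2.comp_hasDerivAt (0:ℝ) h1
  have hs := hline.tendsto_slope_zero_right
  have hs2 : Tendsto (fun θ : ℝ => f x + θ⁻¹ • (f (x + (0 + θ) • (y - x)) - f (x + (0:ℝ) • (y - x)))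
      + C / 2 * (1 - θ) * ‖y - x‖ ^ 2) (𝓝[>] 0)
      (𝓝 (f x + f' (y - x) + C / 2 * (1 - 0) * ‖y - x‖ ^ 2)) := by
    refine (hs.const_add _).add ?_
    have : Continuous fun θ : ℝ => C / 2 * (1 - θ) * ‖y - x‖ ^ 2 := by fun_prop
    exact (this.tendsto 0).mono_left nhdsWithin_le_nhds
  rw [sub_zero, mul_one] at hs2
  refine ge_of_tendsto hs2 ?_
  have : Ioo (0:ℝ) 1 ∈ 𝓝[>] (0:ℝ) := Ioo_mem_nhdsGT one_pos
  filter_upwards [this] with θ hθ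
  have h := hf y x θ hθ.1.le hθ.2.le
  have he : θ • y + (1 - θ) • x = x + θ • (y - x) := by module
  rw [he] at h
  simp only [zero_add, zero_smul, add_zero, smul_eq_mul]
  have hθ0 : θ ≠ 0 := hθ.1.ne'
  have h3 : θ * f y ≤ θ * (f x + θ⁻¹ * (f (x + θ • (y - x)) - f x)
      + C / 2 * (1 - θ) * ‖y - x‖ ^ 2) := by
    have : θ * (f x + θ⁻¹ * (f (x + θ • (y - x)) - f x)
      + C / 2 * (1 - θ) * ‖y - x‖ ^ 2) = θ * f x + (f (x + θ • (y - x)) - f x) +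
        C / 2 * (θ * (1 - θ)) * ‖y - x‖ ^ 2 := by field_simp
    rw [this]; linarith
  exact le_of_mul_le_mul_left h3 hθ.1

lemma aux_grad_tendsto {ι : Type*} {l : Filter ι} {C : ℝ} {φ : ι → V → ℝ} {ψ : V → ℝ}
    {g : ι → V} {g0 : V}
    (h : ∀ᶠ n in l, ∀ v, φ n v ≤ φ n 0 + ⟪g n, v⟫ + C / 2 * ‖v‖ ^ 2)
    (hφ : ∀ v, Tendsto (fun n => φ n v) l (𝓝 (ψ v)))
    (hψ : HasGradientAt ψ g0 0) : Tendsto g l (𝓝 g0) := by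
  -- lower bound in each direction
  have key : ∀ e : V, ∀ η > 0, ∀ᶠ n in l, ⟪g0, e⟫ - η < ⟪g n, e⟫ := by
    intro e η hη
    have hline : HasDerivAt (fun θ : ℝ => ψ (θ • e)) (⟪g0, e⟫) 0 := by
      have h1 : HasDerivAt (fun θ : ℝ => θ • e) e 0 := by
        simpa using ((hasDerivAt_id (0:ℝ)).smul_const e)
      have h2 : HasFDerivAt ψ (InnerProductSpace.toDual ℝ V g0) ((0:ℝ) • e) := by
        simpa using hψ.hasFDerivAt
      exact h2.comp_hasDerivAt (0:ℝ) h1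
    have hs := hline.tendsto_slope_zero_right
    have hs2 : Tendsto (fun θ : ℝ => θ⁻¹ • (ψ ((0 + θ) • e) - ψ ((0:ℝ) • e))
        - C / 2 * θ * ‖e‖ ^ 2) (𝓝[>] 0) (𝓝 (⟪g0, e⟫ - C / 2 * 0 * ‖e‖ ^ 2)) := by
      refine hs.sub ?_
      have : Continuous fun θ : ℝ => C / 2 * θ * ‖e‖ ^ 2 := by fun_prop
      exact (this.tendsto 0).mono_left nhdsWithin_le_nhds
    have hlt : ⟪g0, e⟫ - η < ⟪g0, e⟫ - C / 2 * 0 * ‖e‖ ^ 2 := by simp [hη]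
    obtain ⟨θ, hθ1, hθ0⟩ := ((hs2.eventually (lt_mem_nhds hlt)).and self_mem_nhdsWithin).exists
    have hθ0 : 0 < θ := hθ0
    have ht : Tendsto (fun n => θ⁻¹ • (φ n ((0 + θ) • e) - φ n ((0:ℝ) • e)) - C / 2 * θ * ‖e‖ ^ 2) l
        (𝓝 (θ⁻¹ • (ψ ((0 + θ) • e) - ψ ((0:ℝ) • e)) - C / 2 * θ * ‖e‖ ^ 2)) :=
      (((hφ _).sub (hφ _)).const_smul _).sub_const _
    filter_upwards [h, ht.eventually (lt_mem_nhds hθ1)] with n hn hn2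
    refine hn2.trans_le ?_
    have := hn (θ • e)
    rw [inner_smul_right, norm_smul, Real.norm_of_nonneg hθ0.le] at this
    simp only [zero_add, zero_smul, smul_eq_mul]
    have h4 : θ * (θ⁻¹ * (φ n (θ • e) - φ n 0) - C / 2 * θ * ‖e‖ ^ 2) ≤ θ * ⟪g n, e⟫ := by
      have : θ * (θ⁻¹ * (φ n (θ • e) - φ n 0) - C / 2 * θ * ‖e‖ ^ 2) =
        (φ n (θ • e) - φ n 0) - C / 2 * (θ * ‖e‖) ^ 2 := by field_simp
      rw [this]; linarith
    exact le_of_mul_le_mul_left h4 hθ0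
  have key2 : ∀ e : V, Tendsto (fun n => ⟪g n, e⟫) l (𝓝 ⟪g0, e⟫) := by
    intro e
    rw [Metric.tendsto_nhds]
    intro η hη
    filter_upwards [key e η hη, key (-e) η hη] with n h1 h2
    rw [inner_neg_right, inner_neg_right] at h2
    rw [Real.dist_eq, abs_lt]; constructor <;> linarith
  have hc : Tendsto (fun n => (EuclideanSpace.equiv (Fin d) ℝ) (g n)) l
      (𝓝 ((EuclideanSpace.equiv (Fin d) ℝ) g0)) := by
    rw [tendsto_pi_nhds]
    intro i
    have := key2 (EuclideanSpace.single i 1)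
    simpa [EuclideanSpace.inner_single_right] using this
  have := ((EuclideanSpace.equiv (Fin d) ℝ).symm.continuous.tendsto _).comp hc
  simpa [Function.comp_def] using this

lemma aux_trace_le (A B : V →ₗ[ℝ] V) (hA : A.IsSymmetric) {a C : ℝ} (hC : 0 ≤ C)
    (hA0 : ∀ v, 0 ≤ ⟪A v, v⟫) (hA1 : ∀ v, ⟪A v, v⟫ ≤ a * ‖v‖ ^ 2)
    (hB : ∀ v, ⟪B v, v⟫ ≤ C * ‖v‖ ^ 2) :
    LinearMap.trace ℝ V (A ∘ₗ B) ≤ d * (a * C) := by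
  have hn : Module.finrank ℝ V = d := by simp
  let b := hA.eigenvectorBasis hn
  have : LinearMap.trace ℝ V (A ∘ₗ B) = LinearMap.trace ℝ V (B ∘ₗ A) := LinearMap.trace_comp_comm' B A
  rw [this, LinearMap.trace_eq_sum_inner _ b]
  have hb : ∀ i, ⟪b i, (B ∘ₗ A) (b i)⟫ ≤ a * C := by
    intro i
    have hi : A (b i) = (hA.eigenvalues hn i) • b i := hA.apply_eigenvectorBasis hn i
    have hb1 : ‖b i‖ = 1 := b.orthonormal.1 i
    have h0 := hA0 (b i)
    have h1 := hA1 (b i)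
    have h2 := hB (b i)
    rw [hi, inner_smul_left, real_inner_self_eq_norm_sq, hb1] at h0 h1
    simp at h0 h1
    rw [hb1] at h2
    rw [LinearMap.comp_apply, hi, map_smul, inner_smul_right, real_inner_comm]
    nlinarith
  calc _ ≤ ∑ i : Fin d, a * C := Finset.sum_le_sum fun i _ => hb i
    _ = _ := by simp

lemma aux_trace_norm (A : V →L[ℝ] V) : LinearMap.trace ℝ V (A : V →ₗ[ℝ] V) ≤ d * ‖A‖ := by
  rw [LinearMap.trace_eq_sum_inner _ (EuclideanSpace.basisFun (Fin d) ℝ)]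
  calc _ ≤ ∑ i : Fin d, ‖A‖ := by
        refine Finset.sum_le_sum fun i _ => ?_
        refine (real_inner_le_norm _ _).trans ?_
        have := A.le_opNorm ((EuclideanSpace.basisFun (Fin d) ℝ) i)
        simpa using this
    _ = _ := by simp

lemma aux_det_hasFDerivAt : ∃ D : (V →L[ℝ] V) →L[ℝ] ℝ,
    HasFDerivAt (fun A : V →L[ℝ] V => A.det) D (ContinuousLinearMap.id ℝ V) ∧
    ∀ A : V →L[ℝ] V, D A = LinearMap.trace ℝ V (A : V →ₗ[ℝ] V) := by
  let b := (EuclideanSpace.basisFun (Fin d) ℝ).toBasis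
  have hdet : ∀ A : V →L[ℝ] V, A.det = (LinearMap.toMatrix b b (A : V →ₗ[ℝ] V)).det := by
    intro A
    rw [LinearMap.det_toMatrix]
  have hent : ∀ i j, ∀ A : V →L[ℝ] V, LinearMap.toMatrix b b (A : V →ₗ[ℝ] V) i j = A (b j) i := by
    intro i j A
    simp [LinearMap.toMatrix_apply, b]
  have hdiff : Differentiable ℝ (fun A : V →L[ℝ] V => A.det) := by
    have : (fun A : V →L[ℝ] V => A.det) = fun A : V →L[ℝ] V =>
        ∑ σ : Equiv.Perm (Fin d), (Equiv.Perm.sign σ : ℝ) * ∏ i, (A (b i)) (σ i) := by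
      funext A
      rw [hdet, Matrix.det_apply']
      simp only [hent]
    rw [this]
    fun_prop
  refine ⟨fderiv ℝ (fun A : V →L[ℝ] V => A.det) (ContinuousLinearMap.id ℝ V),
    (hdiff _).hasFDerivAt, fun A => ?_⟩
  have h1 : HasDerivAt (fun r : ℝ => ContinuousLinearMap.id ℝ V + r • A) A 0 := by
    simpa using ((hasDerivAt_id (0:ℝ)).smul_const A).const_add (ContinuousLinearMap.id ℝ V)
  have h2 : HasDerivAt (fun r : ℝ => (ContinuousLinearMap.id ℝ V + r • A).det)
      (fderiv ℝ (fun A : V →L[ℝ] V => A.det) (ContinuousLinearMap.id ℝ V) A) 0 := by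
    have h3 : HasFDerivAt (fun A : V →L[ℝ] V => A.det)
      (fderiv ℝ (fun A : V →L[ℝ] V => A.det) (ContinuousLinearMap.id ℝ V))
      (ContinuousLinearMap.id ℝ V + (0:ℝ) • A) := by
        have h30 : ContinuousLinearMap.id ℝ V + (0:ℝ) • A = ContinuousLinearMap.id ℝ V := by
          ext v : 1
          change v + (0:ℝ) • A v = v
          rw [zero_smul, add_zero]
        rw [h30]
        exact (hdiff (ContinuousLinearMap.id ℝ V)).hasFDerivAt
    exact h3.comp_hasDerivAt (0:ℝ) h1
  let M := LinearMap.toMatrix b b (A : V →ₗ[ℝ] V)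
  let P := Matrix.det (1 + (Polynomial.X : Polynomial ℝ) • M.map Polynomial.C)
  have h4 : HasDerivAt (fun r : ℝ => P.eval r) (P.derivative.eval 0) 0 := P.hasDerivAt 0
  have h5 : (fun r : ℝ => (ContinuousLinearMap.id ℝ V + r • A).det) = fun r : ℝ => P.eval r := by
    funext r
    rw [hdet]
    have : LinearMap.toMatrix b b ((ContinuousLinearMap.id ℝ V + r • A : V →L[ℝ] V) : V →ₗ[ℝ] V)
      = 1 + r • M := by
      have h6 : ((ContinuousLinearMap.id ℝ V + r • A : V →L[ℝ] V) : V →ₗ[ℝ] V) =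
        LinearMap.id + r • (A : V →ₗ[ℝ] V) := rfl
      rw [h6, map_add, map_smul, LinearMap.toMatrix_id]
    rw [this]
    have h7 := congrArg (Polynomial.eval r) (Matrix.det_one_add_X_smul M)
    rw [Matrix.det_one_add_smul]
    simp only [P]
    rw [h7]
    simp [Polynomial.smul_eq_C_mul]
  rw [h5] at h2
  rw [h2.unique h4, Matrix.derivative_det_one_add_X_smul]
  exact (LinearMap.trace_eq_matrix_trace ℝ b (A : V →ₗ[ℝ] V)).symm

lemma aux_det (L c : ℝ) : ∃ h0 > 0, ∀ h : ℝ, 0 ≤ h → h ≤ h0 → ∀ A : V →L[ℝ] V, ‖A‖ ≤ L →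
    LinearMap.trace ℝ V (A : V →ₗ[ℝ] V) ≤ c →
    1 - (c + 1) * h ≤ (ContinuousLinearMap.id ℝ V - h • A).det := by
  obtain ⟨D, hD, hDt⟩ := aux_det_hasFDerivAt (d := d)
  have hL : 0 < |L| + 1 := by positivity
  have h1 := (hasFDerivAt_iff_isLittleO_nhds_zero.1 hD).def (c := 1 / (|L| + 1)) (by positivity)
  obtain ⟨δ, hδ, hball⟩ := Metric.eventually_nhds_iff.1 h1
  refine ⟨δ / (2 * (|L| + 1)), by positivity, fun h hh0 hh A hA htr => ?_⟩
  have hAL : ‖A‖ ≤ |L| + 1 := hA.trans ((le_abs_self L).trans (by linarith))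
  have hn : ‖(-h) • A‖ ≤ h * (|L| + 1) := by
    rw [norm_smul, norm_neg, Real.norm_of_nonneg hh0]; gcongr
  have hlt : ‖(-h) • A‖ < δ := by
    refine hn.trans_lt ?_
    have : h * (|L| + 1) ≤ δ / 2 := by
      calc _ ≤ δ / (2 * (|L| + 1)) * (|L| + 1) := by gcongr
        _ = δ / 2 := by field_simp
    linarith
  have h2 := hball (y := (-h) • A) (by simpa using hlt)
  rw [map_smul, hDt] at h2
  have h3 : ContinuousLinearMap.id ℝ V + (-h) • A = ContinuousLinearMap.id ℝ V - h • A := by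
    ext v : 1
    change v + (-h) • A v = v - h • A v
    rw [neg_smul, sub_eq_add_neg]
  rw [h3] at h2
  have h4 : (ContinuousLinearMap.id ℝ V).det = 1 := by simp [ContinuousLinearMap.det]
  rw [h4, Real.norm_eq_abs] at h2
  have h5 : 1 / (|L| + 1) * ‖(-h) • A‖ ≤ h := by
    calc _ ≤ 1 / (|L| + 1) * (h * (|L| + 1)) := by gcongr
      _ = h := by field_simp
  have h6 := (abs_le.1 (h2.trans h5)).1
  simp only [smul_eq_mul] at h6
  nlinarith [mul_le_mul_of_nonneg_left htr hh0]

lemma aux_push {L c h : ℝ} {β : V → V} {β' : V → V →L[ℝ] V} (hL : 0 ≤ L)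
    (hβ : ∀ x, HasFDerivAt β (β' x) x) (hβL : ∀ x, ‖β' x‖ ≤ L)
    (hh : 0 ≤ h) (hhL : h * L < 1) (hc : 0 ≤ c) (hhc : c * h ≤ 1 / 2)
    (hdet : ∀ x, 1 - c * h ≤ (ContinuousLinearMap.id ℝ V - h • β' x).det)
    (f : V → ℝ≥0∞) : ∫⁻ x, f (x - h • β x) ≤ ENNReal.ofReal (1 + 2 * c * h) * ∫⁻ x, f x := by
  have hψ : ∀ x ∈ (univ : Set V), HasFDerivWithinAt (fun x => x - h • β x)
      (ContinuousLinearMap.id ℝ V - h • β' x) univ x := fun x _ =>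
    ((hasFDerivAt_id x).sub ((hβ x).const_smul h)).hasFDerivWithinAt
  have hlip : LipschitzWith L.toNNReal β := by
    refine lipschitzWith_of_nnnorm_fderiv_le (𝕜 := ℝ) (fun x => (hβ x).differentiableAt) fun x => ?_
    rw [(hβ x).fderiv, ← NNReal.coe_le_coe, Real.coe_toNNReal _ hL]
    exact hβL x
  have hinj : InjOn (fun x => x - h • β x) univ := by
    intro x _ y _ hxy
    have h1 : x - y = h • (β x - β y) := by
      simp only at hxy
      rw [smul_sub, ← sub_eq_zero]
      rw [← sub_eq_zero] at hxy
      rw [← hxy]; abel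
    have h2 : ‖x - y‖ ≤ h * (L * ‖x - y‖) := by
      have h4 := hlip.norm_sub_le x y
      rw [Real.coe_toNNReal _ hL] at h4
      calc ‖x - y‖ = h * ‖β x - β y‖ := by rw [h1, norm_smul, Real.norm_of_nonneg hh]
        _ ≤ _ := by gcongr
    have h3 : ‖x - y‖ = 0 := by nlinarith [norm_nonneg (x - y)]
    exact sub_eq_zero.1 (norm_eq_zero.1 h3)
  have key := lintegral_image_eq_lintegral_abs_det_fderiv_mul volume MeasurableSet.univ hψ hinj f
  rw [Measure.restrict_univ] at key
  have hle : ∫⁻ x, f (x - h • β x) ≤ ENNReal.ofReal (1 + 2 * c * h) *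
      ∫⁻ x, ENNReal.ofReal |(ContinuousLinearMap.id ℝ V - h • β' x).det| * f (x - h • β x) := by
    rw [← lintegral_const_mul' _ _ ENNReal.ofReal_ne_top]
    refine lintegral_mono fun x => ?_
    simp only
    rw [← mul_assoc, ← ENNReal.ofReal_mul (by positivity)]
    refine le_mul_of_one_le_left bot_le ?_
    rw [ENNReal.one_le_ofReal]
    have h1 := (hdet x).trans (le_abs_self _)
    have hch : 0 ≤ c * h := by positivity
    nlinarith
  refine hle.trans ?_
  refine mul_le_mul_right ?_ _
  rw [← key]
  exact setLIntegral_le_lintegral _ _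

def auxBump (d N : ℕ) : ContDiffBump (0 : EuclideanSpace ℝ (Fin d)) :=
  ⟨1 / ((N : ℝ) + 2), 1 / ((N : ℝ) + 1), by positivity, by
    apply one_div_lt_one_div_of_lt <;> [positivity; linarith]⟩

def auxMol (N : ℕ) (f : V → ℝ) : V → ℝ :=
  convolution ((auxBump d N).normed volume) f (ContinuousLinearMap.lsmul ℝ ℝ) volume

lemma auxMol_apply (N : ℕ) (f : V → ℝ) (x : V) :
    auxMol N f x = ∫ y, (auxBump d N).normed volume y * f (x - y) := rfl

lemma auxMol_integrable (N : ℕ) {f : V → ℝ} (hf : Continuous f) (x : V) :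
    Integrable (fun y => (auxBump d N).normed volume y * f (x - y)) := by
  refine Continuous.integrable_of_hasCompactSupport ?_ ?_
  · exact ((auxBump d N).continuous_normed).mul (by fun_prop)
  · exact (auxBump d N).hasCompactSupport_normed.mul_right

lemma auxMol_close (N : ℕ) {f : V → ℝ} {C : ℝ} (hC : 0 ≤ C) (hf : LipschitzWith C.toNNReal f) (x : V) :
    |auxMol N f x - f x| ≤ C / ((N : ℝ) + 1) := by
  rw [← Real.dist_eq]
  refine ContDiffBump.dist_normed_convolution_le hf.continuous.aestronglyMeasurable fun y hy => ?_
  have := hf.dist_le_mul y x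
  rw [Real.coe_toNNReal _ hC] at this
  refine this.trans ?_
  have h2 : dist y x ≤ 1 / ((N:ℝ) + 1) := (Metric.mem_ball.1 hy).le
  calc _ ≤ C * (1 / ((N:ℝ) + 1)) := by gcongr
    _ = _ := by ring

lemma auxMol_contDiff (N : ℕ) {f : V → ℝ} (hf : Continuous f) : ContDiff ℝ 2 (auxMol N f) :=
  (auxBump d N).hasCompactSupport_normed.contDiff_convolution_left _ (auxBump d N).contDiff_normed
    hf.locallyIntegrable

lemma auxMol_const_bound (N : ℕ) {g : V → ℝ} (hg : Continuous g) {K : ℝ} (x : V) (h : ∀ y, g y ≤ K) :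
    auxMol N g x ≤ K := by
  rw [auxMol_apply]
  calc _ ≤ ∫ y, (auxBump d N).normed volume y * K := by
        refine integral_mono (auxMol_integrable N hg x) ?_ fun y => ?_
        · exact (auxBump d N).integrable_normed.mul_const K
        · exact mul_le_mul_of_nonneg_left (h _) ((auxBump d N).nonneg_normed _)
    _ = K := by rw [integral_mul_const, (auxBump d N).integral_normed, one_mul]

lemma auxMol_semiconcave (N : ℕ) {f : V → ℝ} (hf : Continuous f) {C : ℝ} (hs : SemiconcaveWith d C f) :
    SemiconcaveWith d C (auxMol N f) := by
  intro x y θ h0 h1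
  have e : θ * auxMol N f x + (1 - θ) * auxMol N f y - auxMol N f (θ • x + (1 - θ) • y) =
      auxMol N (fun z => θ * f (x + z) + (1 - θ) * f (y + z) - f (θ • x + (1 - θ) • y + z)) 0 := by
    simp only [auxMol_apply, zero_sub, ← sub_eq_add_neg]
    rw [← integral_const_mul, ← integral_const_mul, ← integral_add, ← integral_sub]
    · congr 1; ext z; ring
    · exact ((auxMol_integrable N hf x).const_mul _).add ((auxMol_integrable N hf y).const_mul _)
    · exact auxMol_integrable N hf _
    · exact (auxMol_integrable N hf x).const_mul _
    · exact (auxMol_integrable N hf y).const_mul _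
  rw [e]
  refine auxMol_const_bound N (by fun_prop) 0 fun z => ?_
  have := hs (x + z) (y + z) θ h0 h1
  have e2 : θ • (x + z) + (1 - θ) • (y + z) = θ • x + (1 - θ) • y + z := by module
  rw [e2, add_sub_add_right_eq_sub] at this
  exact this

lemma auxMol_lip (N : ℕ) {f : V → ℝ} {C : ℝ} (hf : LipschitzWith C.toNNReal f) :
    LipschitzWith C.toNNReal (auxMol N f) := by
  refine LipschitzWith.of_le_add_mul _ fun x y => ?_
  have hfc := hf.continuous
  have e : auxMol N f x - auxMol N f y = auxMol N (fun z => f (x + z) - f (y + z)) 0 := by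
    simp only [auxMol_apply, zero_sub, ← sub_eq_add_neg]
    rw [← integral_sub (auxMol_integrable N hfc x) (auxMol_integrable N hfc y)]
    congr 1; ext z; ring
  have : auxMol N f x - auxMol N f y ≤ C.toNNReal * dist x y := by
    rw [e]
    refine auxMol_const_bound N (by fun_prop) 0 fun z => ?_
    have := hf.dist_le_mul (x + z) (y + z)
    rw [dist_add_right, Real.dist_eq] at this
    exact (le_abs_self _).trans this
  linarith

lemma aux_conv_bound {E F : Type*} [NormedAddCommGroup E] [NormedSpace ℝ E]
    [NormedAddCommGroup F] [NormedSpace ℝ F] (L : E →L[ℝ] ℝ →L[ℝ] F) (ζ : V → E)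
    (hζ : ContDiff ℝ 1 ζ) (hc : HasCompactSupport ζ) (C : ℝ) :
    ∃ K : ℝ, 0 ≤ K ∧ ∀ f : V → ℝ, Continuous f → (∀ x, |f x| ≤ C) → ∀ x,
      ‖fderiv ℝ (convolution ζ f L volume) x‖ ≤ K := by
  have hη2 : Continuous (fderiv ℝ ζ) := hζ.continuous_fderiv (by norm_num)
  have hc2 : HasCompactSupport (fderiv ℝ ζ) := hc.fderiv (𝕜 := ℝ)
  refine ⟨∫ y, ‖L‖ * ‖fderiv ℝ ζ y‖ * |C|, ?_, fun f hf hfC x => ?_⟩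
  · exact integral_nonneg fun y => by positivity
  have h2 : fderiv ℝ (convolution ζ f L volume) x =
      convolution (fderiv ℝ ζ) f (L.precompL V) volume x :=
    (hc.hasFDerivAt_convolution_left L hζ hf.locallyIntegrable x).fderiv
  rw [h2, convolution_def]
  refine norm_integral_le_of_norm_le ?_ (ae_of_all _ fun y => ?_)
  · refine ((Continuous.integrable_of_hasCompactSupport hη2.norm hc2.norm).const_mul _).mul_const _
  · have h3 := (hfC (x - y)).trans (le_abs_self C)
    refine ContinuousLinearMap.opNorm_le_bound _ (by positivity) fun v => ?_
    rw [ContinuousLinearMap.precompL_apply]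
    calc _ ≤ ‖L‖ * ‖fderiv ℝ ζ y v‖ * ‖f (x - y)‖ := L.le_opNorm₂ _ _
      _ ≤ ‖L‖ * (‖fderiv ℝ ζ y‖ * ‖v‖) * |C| := by
        gcongr
        · exact ContinuousLinearMap.le_opNorm _ _
        · exact h3
      _ = _ := by ring

lemma auxMol_D2 (N : ℕ) (C : ℝ) : ∃ L : ℝ, 0 ≤ L ∧ ∀ f : V → ℝ, Continuous f → (∀ x, |f x| ≤ C) → ∀ x,
    ‖fderiv ℝ (fderiv ℝ (auxMol N f)) x‖ ≤ L := by
  let η : V → ℝ := (auxBump d N).normed volume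
  have hη : ContDiff ℝ 2 η := (auxBump d N).contDiff_normed
  have hc0 : HasCompactSupport η := (auxBump d N).hasCompactSupport_normed
  have hη1 : ContDiff ℝ 1 (fderiv ℝ η) := hη.fderiv_right (by norm_num)
  have hc1 : HasCompactSupport (fderiv ℝ η) := hc0.fderiv (𝕜 := ℝ)
  have h1 : ∀ f : V → ℝ, Continuous f → fderiv ℝ (auxMol N f) = convolution (fderiv ℝ η) f
      (ContinuousLinearMap.precompL V (ContinuousLinearMap.lsmul ℝ ℝ)) volume := by
    intro f hf
    funext y
    exact (hc0.hasFDerivAt_convolution_left (ContinuousLinearMap.lsmul ℝ ℝ)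
      (hη.of_le (by norm_num)) hf.locallyIntegrable y).fderiv
  obtain ⟨K, hK, hb⟩ := aux_conv_bound
    (ContinuousLinearMap.precompL V (ContinuousLinearMap.lsmul ℝ ℝ)) (fderiv ℝ η) hη1 hc1 C
  refine ⟨K, hK, fun f hf hfC x => ?_⟩
  rw [h1 f hf]
  exact hb f hf hfC x

lemma aux_second_order {C : ℝ} {f : V → ℝ} (hs : SemiconcaveWith d C f) (hf : Differentiable ℝ f)
    {Q : V →L[ℝ] V →L[ℝ] ℝ} {x : V} (hQ : HasFDerivAt (fderiv ℝ f) Q x) (v : V) :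
    Q v v ≤ C * ‖v‖ ^ 2 := by
  have hline : HasDerivAt (fun θ : ℝ => fderiv ℝ f (x + θ • v) v) (Q v v) 0 := by
    have h1 : HasDerivAt (fun θ : ℝ => x + θ • v) v 0 := by
      simpa using ((hasDerivAt_id (0:ℝ)).smul_const v).const_add x
    have h2 : HasFDerivAt (fderiv ℝ f) Q (x + (0:ℝ) • v) := by simpa using hQ
    have h3 : HasDerivAt (fun θ : ℝ => fderiv ℝ f (x + θ • v)) (Q v) 0 :=
      h2.comp_hasDerivAt (0:ℝ) h1
    exact ((ContinuousLinearMap.apply ℝ ℝ v).hasFDerivAt).comp_hasDerivAt (0:ℝ) h3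
  refine le_of_tendsto hline.tendsto_slope_zero_right ?_
  filter_upwards [self_mem_nhdsWithin] with θ hθ
  have hθ : 0 < θ := hθ
  have h1 := aux_first_order hs (hf (x + θ • v)).hasFDerivAt x
  have h2 := aux_first_order hs (hf x).hasFDerivAt (x + θ • v)
  have e1 : x - (x + θ • v) = -(θ • v) := by abel
  have e2 : x + θ • v - x = θ • v := by abel
  rw [e1, map_neg, map_smul, norm_neg, norm_smul, Real.norm_of_nonneg hθ.le] at h1
  rw [e2, map_smul, norm_smul, Real.norm_of_nonneg hθ.le] at h2
  simp only [smul_eq_mul, zero_add, zero_smul, add_zero] at h1 h2 ⊢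
  rw [inv_mul_le_iff₀ hθ]
  have h3 : θ * (fderiv ℝ f (x + θ • v) v - fderiv ℝ f x v) ≤ θ * (θ * (C * ‖v‖ ^ 2)) := by
    nlinarith
  exact le_of_mul_le_mul_left h3 hθ

lemma aux_convex_semi {f : V → ℝ} (hf : ConvexOn ℝ univ f) : SemiconcaveWith d 0 (fun p => - f p) := by
  intro x y θ h0 h1
  have := hf.2 (mem_univ x) (mem_univ y) h0 (sub_nonneg.2 h1) (by ring)
  simp only [smul_eq_mul] at this
  simp only [zero_div, zero_mul]
  linarith

def auxGr (h : V → V → ℝ) (p x : V) : V := gradient (fun q : V => h q x) p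

lemma auxGr_contDiff {h : V → V → ℝ} (hh : ContDiff ℝ 2 fun q : V × V => h q.1 q.2) :
    ContDiff ℝ 1 fun q : V × V => auxGr h q.1 q.2 := by
  have e : (fun q : V × V => auxGr h q.1 q.2) = fun q : V × V =>
      (InnerProductSpace.toDual ℝ V).symm ((fderiv ℝ (fun q : V × V => h q.1 q.2) q).comp
        (ContinuousLinearMap.inl ℝ V V)) := by
    funext q
    have h1 : HasFDerivAt (fun p : V => (p, q.2)) (ContinuousLinearMap.inl ℝ V V) q.1 :=
      hasFDerivAt_prodMk_left q.1 q.2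
    have h2 : HasFDerivAt (fun q : V × V => h q.1 q.2) (fderiv ℝ (fun q : V × V => h q.1 q.2) q)
      (q.1, q.2) := (hh.differentiable (by norm_num) q).hasFDerivAt
    have h3 := h2.comp q.1 h1
    simp only [auxGr, gradient]
    congr 1
    exact h3.fderiv
  rw [e]
  have h1 : ContDiff ℝ 1 (fderiv ℝ (fun q : V × V => h q.1 q.2)) := hh.fderiv_right (by norm_num)
  exact (InnerProductSpace.toDual ℝ V).symm.contDiff.comp (h1.clm_comp contDiff_const)

def auxJ (d : ℕ) : EuclideanSpace ℝ (Fin d) →L[ℝ] (EuclideanSpace ℝ (Fin d) →L[ℝ] ℝ) :=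
  LinearMap.toContinuousLinearMap
    { toFun := fun v => InnerProductSpace.toDual ℝ _ v
      map_add' := fun v w => map_add _ v w
      map_smul' := fun c v => by simp }

lemma auxJ_eq (v : V) : auxJ d v = InnerProductSpace.toDual ℝ V v := rfl

lemma auxJ_apply (v w : V) : auxJ d v w = ⟪v, w⟫ := rfl

lemma aux_field {h : V → V → ℝ} (hh : ContDiff ℝ 2 fun q : V × V => h q.1 q.2)
    (hconv : ∀ x, ConvexOn ℝ univ fun p => h p x) {R K C L : ℝ} (hC : 0 ≤ C)
    (hK : ∀ p x : V, ‖p‖ ≤ R → ‖fderiv ℝ (fun q : V => h q x) p‖ ≤ K ∧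
        ‖fderiv ℝ (fun y : V => fderiv ℝ (fun q : V => h q y) p) x‖ ≤ K ∧
        ‖iteratedFDeriv ℝ 2 (fun q : V => h q x) p‖ ≤ K)
    {f : V → ℝ} (hf : ContDiff ℝ 2 f) (hfR : ∀ x, ‖fderiv ℝ f x‖ ≤ R)
    (hfL : ∀ x, ‖fderiv ℝ (fderiv ℝ f) x‖ ≤ L) (hs : SemiconcaveWith d C f) :
    Continuous (fun x => auxGr h (gradient f x) x) ∧
    (∀ x, ‖auxGr h (gradient f x) x‖ ≤ K) ∧
    ∃ β' : V → V →L[ℝ] V, ∀ x, HasFDerivAt (fun x => auxGr h (gradient f x) x) (β' x) x ∧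
      ‖β' x‖ ≤ K * L + K ∧ LinearMap.trace ℝ V (β' x : V →ₗ[ℝ] V) ≤ d * (K * C) + d * K := by
  have hgr : ContDiff ℝ 1 (gradient f) := by
    have h1 : ContDiff ℝ 1 (fderiv ℝ f) := hf.fderiv_right (by norm_num)
    exact (InnerProductSpace.toDual ℝ V).symm.contDiff.comp h1
  have hgn : ∀ x, ‖gradient f x‖ ≤ R := fun x => by
    simp only [gradient, LinearIsometryEquiv.norm_map]; exact hfR x
  have hG := auxGr_contDiff hh
  refine ⟨hG.continuous.comp (hgr.continuous.prodMk continuous_id), fun x => ?_, ?_⟩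
  · simp only [auxGr]
    rw [gradient, LinearIsometryEquiv.norm_map]
    exact (hK _ x (hgn x)).1
  let D : V → (V × V →L[ℝ] V) := fun x => fderiv ℝ (fun q : V × V => auxGr h q.1 q.2) (gradient f x, x)
  have hD : ∀ x, HasFDerivAt (fun q : V × V => auxGr h q.1 q.2) (D x) (gradient f x, x) := fun x =>
    (hG.differentiable (by norm_num) _).hasFDerivAt
  let B : V → V →L[ℝ] V := fun x => fderiv ℝ (gradient f) x
  have hB : ∀ x, HasFDerivAt (gradient f) (B x) x := fun x =>
    (hgr.differentiable (by norm_num) x).hasFDerivAt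
  let A : V → V →L[ℝ] V := fun x => (D x).comp (ContinuousLinearMap.inl ℝ V V)
  let A2 : V → V →L[ℝ] V := fun x => (D x).comp (ContinuousLinearMap.inr ℝ V V)
  have hA : ∀ x, HasFDerivAt (fun q => auxGr h q x) (A x) (gradient f x) := fun x => by
    have h1 : HasFDerivAt (fun p : V => (p, x)) (ContinuousLinearMap.inl ℝ V V) (gradient f x) :=
      hasFDerivAt_prodMk_left (gradient f x) x
    exact HasFDerivAt.comp (gradient f x) (hD x) h1
  have hA2 : ∀ x, HasFDerivAt (fun y => auxGr h (gradient f x) y) (A2 x) x := fun x => by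
    have h1 : HasFDerivAt (fun p : V => (gradient f x, p)) (ContinuousLinearMap.inr ℝ V V) x :=
      hasFDerivAt_prodMk_right (gradient f x) x
    exact HasFDerivAt.comp x (hD x) h1
  have hslice : ∀ x, ContDiff ℝ 2 (fun q => h q x) := fun x =>
    hh.comp (contDiff_id.prodMk contDiff_const)
  -- relation with the dual derivatives
  have dual_ap : ∀ (g : V → V →L[ℝ] ℝ) (A : V →L[ℝ] V) (p : V),
      HasFDerivAt (fun q => (InnerProductSpace.toDual ℝ V).symm (g q)) A p →
      HasFDerivAt g ((auxJ d).comp A) p := by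
    intro g A p hA
    have := (auxJ d).hasFDerivAt.comp p hA
    have e : g = (auxJ d) ∘ fun q => (InnerProductSpace.toDual ℝ V).symm (g q) := by
      funext q
      simp [auxJ_eq]
    rw [← e] at this
    exact this
  have dual_norm : ∀ A : V →L[ℝ] V,
      ‖A‖ ≤ ‖(auxJ d).comp A‖ := by
    intro A
    refine ContinuousLinearMap.opNorm_le_bound _ (ContinuousLinearMap.opNorm_nonneg _) fun v => ?_
    have := ((auxJ d).comp A).le_opNorm v
    simpa [auxJ_eq] using this
  have hA' := fun x => dual_ap (fderiv ℝ (fun q => h q x)) (A x) _ (hA x)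
  have hA2' := fun x => dual_ap (fun y => fderiv ℝ (fun q => h q y) (gradient f x)) (A2 x) _ (hA2 x)
  have hB' := fun x => dual_ap (fderiv ℝ f) (B x) _ (hB x)
  have hAn : ∀ x, ‖A x‖ ≤ K := by
    intro x
    refine (dual_norm _).trans ?_
    rw [← (hA' x).fderiv, ← norm_iteratedFDeriv_one, norm_iteratedFDeriv_fderiv]
    exact (hK _ x (hgn x)).2.2
  have hA2n : ∀ x, ‖A2 x‖ ≤ K := by
    intro x
    refine (dual_norm _).trans ?_
    rw [← (hA2' x).fderiv]
    exact (hK _ x (hgn x)).2.1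
  have hBn : ∀ x, ‖B x‖ ≤ L := by
    intro x
    refine (dual_norm _).trans ?_
    rw [← (hB' x).fderiv]
    exact hfL x
  refine ⟨fun x => (A x).comp (B x) + A2 x, fun x => ⟨?_, ?_, ?_⟩⟩
  · have h1 : HasFDerivAt (fun x => (gradient f x, x)) ((B x).prod (ContinuousLinearMap.id ℝ V)) x :=
      (hB x).prodMk (hasFDerivAt_id x)
    have hD' : HasFDerivAt (fun q : V × V => auxGr h q.1 q.2) (D x)
      ((fun x => (gradient f x, x)) x) := hD x
    have h2 := HasFDerivAt.comp (f := fun x => (gradient f x, x)) x hD' h1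
    have e : (A x).comp (B x) + A2 x = (D x).comp ((B x).prod (ContinuousLinearMap.id ℝ V)) := by
      ext v : 1
      change D x (B x v, 0) + D x (0, v) = D x (B x v, v)
      rw [← map_add]; simp
    rw [← e] at h2
    exact h2
  · have hK0 : 0 ≤ K := (norm_nonneg _).trans (hAn x)
    refine (norm_add_le _ _).trans (add_le_add ?_ (hA2n x))
    refine (ContinuousLinearMap.opNorm_comp_le _ _).trans ?_
    gcongr
    · exact hAn x
    · exact hBn x
  · have e : ((((A x).comp (B x) + A2 x : V →L[ℝ] V)) : V →ₗ[ℝ] V) =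
      (A x : V →ₗ[ℝ] V) ∘ₗ (B x : V →ₗ[ℝ] V) + (A2 x : V →ₗ[ℝ] V) := rfl
    rw [e, map_add]
    have hQ := hA' x
    refine add_le_add (aux_trace_le _ _ ?_ hC ?_ ?_ ?_) ?_
    · intro v w
      have hsym : IsSymmSndFDerivAt ℝ (fun q => h q x) (gradient f x) :=
        ((hslice x).contDiffAt).isSymmSndFDerivAt (by simp)
      have := hsym v w
      rw [hQ.fderiv] at this
      have h2 : ⟪A x v, w⟫ = ⟪A x w, v⟫ := by simpa [auxJ_apply] using this
      simp only [ContinuousLinearMap.coe_coe]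
      rw [h2, real_inner_comm]
    · intro v
      have hdiff : Differentiable ℝ (fun p => - h p x) := ((hslice x).differentiable (by norm_num)).neg
      have h1 : HasFDerivAt (fderiv ℝ (fun p => - h p x))
          (-((auxJ d).comp (A x)))
          (gradient f x) := by
        have e3 : fderiv ℝ (fun p => - h p x) = fun p => - fderiv ℝ (fun p => h p x) p := by
          funext p; exact fderiv_neg
        rw [e3]
        exact hQ.neg
      have := aux_second_order (aux_convex_semi (hconv x)) hdiff h1 v
      simp [auxJ_apply] at this
      simpa using this
    · intro v
      simp only [ContinuousLinearMap.coe_coe]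
      refine (real_inner_le_norm _ _).trans ?_
      have := (A x).le_opNorm v
      have := hAn x
      nlinarith [norm_nonneg v, mul_le_mul_of_nonneg_right this (norm_nonneg v)]
    · intro v
      have := aux_second_order hs (hf.differentiable (by norm_num)) (hB' x) v
      simpa [auxJ_apply] using this
    · refine (aux_trace_norm _).trans ?_
      gcongr
      exact hA2n x

lemma aux_inner_grad (f : V → ℝ) (x v : V) : ⟪gradient f x, v⟫ = fderiv ℝ f x v := by
  simp [gradient]

lemma aux_norm_grad (f : V → ℝ) (x : V) : ‖gradient f x‖ = ‖fderiv ℝ f x‖ := by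
  simp [gradient]

lemma aux_grad_lim {C : ℝ} {f : ℕ → V → ℝ} {f0 : V → ℝ} {x : V}
    (hs : ∀ n, SemiconcaveWith d C (f n)) (hd : ∀ n, DifferentiableAt ℝ (f n) x)
    (hlim : ∀ y, Tendsto (fun n => f n y) atTop (𝓝 (f0 y))) (hd0 : DifferentiableAt ℝ f0 x) :
    Tendsto (fun n => gradient (f n) x) atTop (𝓝 (gradient f0 x)) := by
  refine aux_grad_tendsto (C := C) (φ := fun n v => f n (x + v)) (ψ := fun v => f0 (x + v)) ?_ ?_ ?_
  · refine Eventually.of_forall fun n v => ?_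
    have := aux_first_order (hs n) (hd n).hasFDerivAt (x + v)
    simpa [aux_inner_grad] using this
  · exact fun v => hlim _
  · have h1 : HasGradientAt f0 (gradient f0 x) (x + 0) := by simpa using hd0.hasGradientAt
    rw [hasGradientAt_iff_hasFDerivAt] at h1 ⊢
    exact (hasFDerivAt_comp_add_left x).2 h1

lemma aux_grad_convex {k : ℕ → V → ℝ} {k0 : V → ℝ} {p : ℕ → V} {p0 : V}
    (hk : ∀ n, ConvexOn ℝ univ (k n)) (hd : ∀ n, Differentiable ℝ (k n))
    (hK : ∀ R : ℝ, ∃ K : ℝ, ∀ n q, ‖q‖ ≤ R → ‖fderiv ℝ (k n) q‖ ≤ K)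
    (hlim : ∀ q, Tendsto (fun n => k n q) atTop (𝓝 (k0 q))) (hd0 : DifferentiableAt ℝ k0 p0)
    (hp : Tendsto p atTop (𝓝 p0)) :
    Tendsto (fun n => gradient (k n) (p n)) atTop (𝓝 (gradient k0 p0)) := by
  have key : Tendsto (fun n => -gradient (k n) (p n)) atTop (𝓝 (-gradient k0 p0)) := by
    refine aux_grad_tendsto (C := 0) (φ := fun n v => - k n (p n + v)) (ψ := fun v => - k0 (p0 + v))
      ?_ ?_ ?_
    · refine Eventually.of_forall fun n v => ?_
      have := aux_first_order (aux_convex_semi (hk n)) (hd n (p n)).hasFDerivAt.neg (p n + v)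
      simp [inner_neg_left, aux_inner_grad] at this ⊢
      linarith
    · intro v
      refine Tendsto.neg ?_
      obtain ⟨K, hK⟩ := hK (‖p0‖ + 1 + ‖v‖)
      have hb : ∀ᶠ n in atTop, ‖k n (p n + v) - k n (p0 + v)‖ ≤ K * ‖p n - p0‖ := by
        filter_upwards [hp (Metric.ball_mem_nhds p0 one_pos)] with n hn
        have hn : dist (p n) p0 < 1 := hn
        have hconv : Convex ℝ (Metric.closedBall (0:V) (‖p0‖ + 1 + ‖v‖)) := convex_closedBall _ _
        have := hconv.norm_image_sub_le_of_norm_fderiv_le (f := k n) (C := K) (𝕜 := ℝ)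
          (x := p0 + v) (y := p n + v) (fun q _ => hd n q)
          (fun q hq => hK n q (by simpa using hq)) ?_ ?_
        · simpa using this
        · simp only [mem_closedBall_zero_iff]
          linarith [norm_add_le p0 v]
        · simp only [mem_closedBall_zero_iff]
          rw [dist_eq_norm] at hn
          have h2 : ‖p n‖ ≤ ‖p0‖ + ‖p n - p0‖ := by
            simpa using norm_add_le p0 (p n - p0)
          linarith [norm_add_le (p n) v]
      have h0 : Tendsto (fun n => K * ‖p n - p0‖) atTop (𝓝 0) := by
        have := (tendsto_iff_norm_sub_tendsto_zero.1 hp).const_mul K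
        simpa using this
      have h1 := squeeze_zero_norm' hb h0
      have h2 := h1.add (hlim (p0 + v))
      simpa using h2
    · have h1 : HasGradientAt k0 (gradient k0 p0) (p0 + 0) := by simpa using hd0.hasGradientAt
      rw [hasGradientAt_iff_hasFDerivAt] at h1 ⊢
      have := ((hasFDerivAt_comp_add_left p0).2 h1).neg
      rw [map_neg]
      exact this
  simpa using key.neg

lemma aux_semi_iff {C : ℝ} {f : V → ℝ} (hf : Continuous f) :
    SemiconcaveWith d C f ↔ ∀ n : ℕ, (fun q : V × V × Icc (0:ℝ) 1 =>
      (q.2.2 : ℝ) * f q.1 + (1 - (q.2.2 : ℝ)) * f q.2.1 - f ((q.2.2 : ℝ) • q.1 + (1 - (q.2.2 : ℝ)) • q.2.1)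
        - C / 2 * ((q.2.2 : ℝ) * (1 - (q.2.2 : ℝ))) * ‖q.1 - q.2.1‖ ^ 2)
        (TopologicalSpace.denseSeq (V × V × Icc (0:ℝ) 1) n) ≤ 0 := by
  constructor
  · intro h n
    have := h (TopologicalSpace.denseSeq (V × V × Icc (0:ℝ) 1) n).1
      (TopologicalSpace.denseSeq (V × V × Icc (0:ℝ) 1) n).2.1
      (TopologicalSpace.denseSeq (V × V × Icc (0:ℝ) 1) n).2.2
      (TopologicalSpace.denseSeq (V × V × Icc (0:ℝ) 1) n).2.2.2.1
      (TopologicalSpace.denseSeq (V × V × Icc (0:ℝ) 1) n).2.2.2.2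
    simp only
    linarith
  · intro h x y θ h0 h1
    have hcl : IsClosed {q : V × V × Icc (0:ℝ) 1 |
      (q.2.2 : ℝ) * f q.1 + (1 - (q.2.2 : ℝ)) * f q.2.1 - f ((q.2.2 : ℝ) • q.1 + (1 - (q.2.2 : ℝ)) • q.2.1)
        - C / 2 * ((q.2.2 : ℝ) * (1 - (q.2.2 : ℝ))) * ‖q.1 - q.2.1‖ ^ 2 ≤ 0} := by
      refine isClosed_le ?_ continuous_const
      fun_prop
    have := (TopologicalSpace.denseRange_denseSeq (V × V × Icc (0:ℝ) 1)).induction_on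
      (p := fun q : V × V × Icc (0:ℝ) 1 =>
      (q.2.2 : ℝ) * f q.1 + (1 - (q.2.2 : ℝ)) * f q.2.1 - f ((q.2.2 : ℝ) • q.1 + (1 - (q.2.2 : ℝ)) • q.2.1)
        - C / 2 * ((q.2.2 : ℝ) * (1 - (q.2.2 : ℝ))) * ‖q.1 - q.2.1‖ ^ 2 ≤ 0) (x, y, ⟨θ, h0, h1⟩) hcl h
    simp only at this
    linarith

def auxU (C : ℝ) (w : ℕ → ℝ) (x : V) : ℝ :=
  ⨅ n, (max (-C) (min C (w n)) + C * dist x (TopologicalSpace.denseSeq V n))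

lemma auxU_bdd {C : ℝ} (hC : 0 ≤ C) (w : ℕ → ℝ) (x : V) :
    BddBelow (range fun n => (max (-C) (min C (w n)) + C * dist x (TopologicalSpace.denseSeq V n))) := by
  refine ⟨-C, ?_⟩
  rintro _ ⟨n, rfl⟩
  have := le_max_left (-C) (min C (w n))
  have : 0 ≤ C * dist x (TopologicalSpace.denseSeq V n) := by positivity
  simp only
  linarith

lemma auxU_lip {C : ℝ} (hC : 0 ≤ C) (w : ℕ → ℝ) : LipschitzWith C.toNNReal (auxU (d := d) C w) := by
  refine LipschitzWith.of_le_add_mul _ fun x y => ?_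
  rw [Real.coe_toNNReal _ hC, ← sub_le_iff_le_add]
  refine le_ciInf fun n => ?_
  have h1 := ciInf_le (auxU_bdd hC w x) n
  have h2 := mul_le_mul_of_nonneg_left (dist_triangle x y (TopologicalSpace.denseSeq V n)) hC
  simp only [auxU] at *
  linarith

lemma auxU_abs {C : ℝ} (hC : 0 ≤ C) (w : ℕ → ℝ) (x : V) : |auxU C w x| ≤ C := by
  rw [abs_le]
  constructor
  · refine le_ciInf fun n => ?_
    have := le_max_left (-C) (min C (w n))
    have : 0 ≤ C * dist x (TopologicalSpace.denseSeq V n) := by positivity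
    linarith
  · refine (TopologicalSpace.denseRange_denseSeq V).induction_on (p := fun x => auxU C w x ≤ C) x
      (isClosed_le (auxU_lip hC w).continuous continuous_const) fun n => ?_
    refine (ciInf_le (auxU_bdd hC w _) n).trans ?_
    simp [hC]

lemma auxU_eq {C : ℝ} (hC : 0 ≤ C) {f : V → ℝ} (hf : LipschitzWith C.toNNReal f) (hb : ∀ x, |f x| ≤ C) :
    auxU C (fun n => f (TopologicalSpace.denseSeq V n)) = f := by
  have hcl : ∀ n, max (-C) (min C (f (TopologicalSpace.denseSeq V n))) = f (TopologicalSpace.denseSeq V n) := by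
    intro n
    have := abs_le.1 (hb (TopologicalSpace.denseSeq V n))
    rw [min_eq_right this.2, max_eq_right this.1]
  have : ∀ n, auxU C (fun n => f (TopologicalSpace.denseSeq V n)) (TopologicalSpace.denseSeq V n) =
      f (TopologicalSpace.denseSeq V n) := by
    intro n
    refine le_antisymm ((ciInf_le (auxU_bdd hC _ _) n).trans ?_) (le_ciInf fun m => ?_)
    · rw [hcl]; simp
    · rw [hcl]
      have := hf.le_add_mul (TopologicalSpace.denseSeq V n) (TopologicalSpace.denseSeq V m)
      rwa [Real.coe_toNNReal _ hC] at this
  refine DenseRange.equalizer (TopologicalSpace.denseRange_denseSeq V) (auxU_lip hC _).continuous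
    hf.continuous ?_
  funext n
  exact this n

lemma auxU_meas (C : ℝ) (x : V) : Measurable fun w : ℕ → ℝ => auxU C w x := by
  refine Measurable.iInf fun n => ?_
  fun_prop

lemma aux_semi_meas {C : ℝ} (hC : 0 ≤ C) : MeasurableSet {w : ℕ → ℝ | SemiconcaveWith d C (auxU C w)} := by
  simp only [aux_semi_iff (auxU_lip hC _).continuous]
  rw [Set.ofPred_forall]
  refine MeasurableSet.iInter fun n => ?_
  refine measurableSet_le ?_ measurable_const
  have := fun x : V => auxU_meas C x
  refine Measurable.sub_const (Measurable.sub (Measurable.add ?_ ?_) (this _)) _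
  · exact (this _).const_mul _
  · exact (this _).const_mul _

open Classical in
def auxV (C : ℝ) (w : ℕ → ℝ) (x : V) : ℝ := if SemiconcaveWith d C (auxU C w) then auxU C w x else 0

lemma auxV_meas {C : ℝ} (hC : 0 ≤ C) (x : V) : Measurable fun w : ℕ → ℝ => auxV C w x :=
  Measurable.ite (aux_semi_meas hC) (auxU_meas C x) measurable_const

lemma auxV_lip {C : ℝ} (hC : 0 ≤ C) (w : ℕ → ℝ) : LipschitzWith C.toNNReal (auxV (d := d) C w) := by
  by_cases h : SemiconcaveWith d C (auxU C w)
  · have : auxV (d := d) C w = auxU C w := by funext x; simp [auxV, h]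
    rw [this]; exact auxU_lip hC w
  · have : auxV (d := d) C w = fun _ => 0 := by funext x; simp [auxV, h]
    rw [this]; exact (LipschitzWith.const' _)

lemma auxV_semi {C : ℝ} (hC : 0 ≤ C) (w : ℕ → ℝ) : SemiconcaveWith d C (auxV (d := d) C w) := by
  by_cases h : SemiconcaveWith d C (auxU C w)
  · have : auxV (d := d) C w = auxU C w := by funext x; simp [auxV, h]
    rw [this]; exact h
  · have : auxV (d := d) C w = fun _ => 0 := by funext x; simp [auxV, h]
    rw [this]
    intro x y θ h0 h1
    have : 0 ≤ 1 - θ := by linarith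
    simp only [mul_zero, add_zero, sub_zero]
    positivity

lemma auxV_abs {C : ℝ} (hC : 0 ≤ C) (w : ℕ → ℝ) (x : V) : |auxV C w x| ≤ C := by
  unfold auxV
  split_ifs
  · exact auxU_abs hC w x
  · simpa using hC

lemma auxV_eq {C : ℝ} (hC : 0 ≤ C) {f : V → ℝ} (hf : LipschitzWith C.toNNReal f) (hb : ∀ x, |f x| ≤ C)
    (hs : SemiconcaveWith d C f) :
    auxV C (fun n => f (TopologicalSpace.denseSeq V n)) = f := by
  funext x
  simp [auxV, auxU_eq hC hf hb, hs]

lemma aux_grad_meas {α : Type*} [MeasurableSpace α] {f : α → V → ℝ} (hm : ∀ x, Measurable fun a => f a x)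
    (x : V) (hd : ∀ a, DifferentiableAt ℝ (f a) x) : Measurable fun a => gradient (f a) x := by
  have h1 : ∀ v : V, Measurable fun a => fderiv ℝ (f a) x v := by
    intro v
    refine measurable_of_tendsto_metrizable (f := fun (n : ℕ) a =>
      ((n:ℝ) + 1) * (f a (x + (1 / ((n:ℝ) + 1)) • v) - f a x)) (fun n => ?_) ?_
    · exact ((hm _).sub (hm _)).const_mul _
    · rw [tendsto_pi_nhds]
      intro a
      have hline : HasDerivAt (fun θ : ℝ => f a (x + θ • v)) (fderiv ℝ (f a) x v) 0 := by
        have h1 : HasDerivAt (fun θ : ℝ => x + θ • v) v 0 := by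
          simpa using ((hasDerivAt_id (0:ℝ)).smul_const v).const_add x
        have h2 : HasFDerivAt (f a) (fderiv ℝ (f a) x) (x + (0:ℝ) • v) := by
          simpa using (hd a).hasFDerivAt
        exact h2.comp_hasDerivAt (0:ℝ) h1
      have h2 := hline.tendsto_slope_zero
      have h3 : Tendsto (fun n : ℕ => 1 / ((n:ℝ) + 1)) atTop (𝓝[≠] 0) := by
        rw [tendsto_nhdsWithin_iff]
        exact ⟨tendsto_one_div_add_atTop_nhds_zero_nat, Eventually.of_forall fun n => by
          simp only [mem_compl_iff, mem_singleton_iff]; positivity⟩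
      refine (h2.comp h3).congr fun n => ?_
      simp
  have h2 : ∀ i, Measurable fun a => gradient (f a) x i := by
    intro i
    have := h1 (EuclideanSpace.single i 1)
    have e : (fun a => gradient (f a) x i) = fun a => fderiv ℝ (f a) x (EuclideanSpace.single i 1) := by
      funext a
      rw [← aux_inner_grad, EuclideanSpace.inner_single_right]
      simp
    rw [e]
    exact this
  have h3 : Measurable fun a => (WithLp.ofLp (gradient (f a) x)) := measurable_pi_iff.2 h2
  exact (MeasurableEquiv.toLp 2 (Fin d → ℝ)).measurable.comp h3

lemma auxMol_meas {α : Type*} [MeasurableSpace α] (N : ℕ) {f : α → V → ℝ}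
    (hm : ∀ x, Measurable fun a => f a x) (hc : ∀ a, Continuous (f a)) (x : V) :
    Measurable fun a => auxMol N (f a) x := by
  have hj : Measurable (Function.uncurry fun y a => f a y) :=
    measurable_uncurry_of_continuous_of_measurable (u := fun y a => f a y) hc hm
  simp only [auxMol_apply]
  refine StronglyMeasurable.measurable ?_
  refine StronglyMeasurable.integral_prod_right (f := fun (a : α) (y : V) => _ * f a (x - y)) ?_
  refine Measurable.stronglyMeasurable ?_
  refine Measurable.mul ?_ ?_
  · have : Continuous fun y : V => (auxBump d N).normed volume y := ContDiffBump.continuous_normed _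
    exact this.measurable.comp measurable_snd
  · exact hj.comp ((measurable_const.sub measurable_snd).prodMk measurable_fst)

lemma aux_field_meas {α : Type*} [MeasurableSpace α] (N : ℕ) {f : α → V → ℝ}
    (hm : ∀ x, Measurable fun a => f a x) (hc : ∀ a, Continuous (f a))
    {h : α → V → V → ℝ} (hh : ∀ a, ContDiff ℝ 2 fun q : V × V => h a q.1 q.2)
    (hhm : ∀ p x, Measurable fun a => h a p x) :
    Measurable fun q : α × V => auxGr (h q.1) (gradient (auxMol N (f q.1)) q.2) q.2 := by
  have hC2 : ∀ a, ContDiff ℝ 2 (auxMol N (f a)) := fun a => auxMol_contDiff N (hc a)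
  have g1 : Measurable (Function.uncurry fun (x : V) a => gradient (auxMol N (f a)) x) := by
    refine measurable_uncurry_of_continuous_of_measurable ?_ ?_
    · intro a
      have h1 : ContDiff ℝ 1 (fderiv ℝ (auxMol N (f a))) := (hC2 a).fderiv_right (by norm_num)
      exact ((InnerProductSpace.toDual ℝ V).symm.contDiff.comp h1).continuous
    · intro x
      exact aux_grad_meas (fun y => auxMol_meas N hm hc y) x
        fun a => (hC2 a).differentiable (by norm_num) x
  have g2 : Measurable (Function.uncurry fun (q : V × V) a => auxGr (h a) q.1 q.2) := by
    refine measurable_uncurry_of_continuous_of_measurable ?_ ?_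
    · intro a
      exact (auxGr_contDiff (hh a)).continuous
    · intro q
      exact aux_grad_meas (fun y => hhm y q.2) q.1
        fun a => ((hh a).comp (contDiff_id.prodMk contDiff_const)).differentiable (by norm_num) q.1
  exact g2.comp (((g1.comp measurable_swap).prodMk measurable_snd).prodMk measurable_fst)

lemma aux_all_t {T : ℝ} (hT : 0 < T) {C : ℝ} {v : ℝ → V → ℝ}
    (hc : ∀ x, ContinuousOn (fun t => v t x) (Icc 0 T))
    (hb : ∀ᵐ t ∂(volume.restrict (Icc (0:ℝ) T)), (∀ x, |v t x| ≤ C) ∧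
      LipschitzWith C.toNNReal (v t) ∧ SemiconcaveWith d C (v t)) :
    ∀ t ∈ Icc (0:ℝ) T, (∀ x, |v t x| ≤ C) ∧
      LipschitzWith C.toNNReal (v t) ∧ SemiconcaveWith d C (v t) := by
  intro t ht
  rw [ae_restrict_iff' measurableSet_Icc] at hb
  have hd := Measure.dense_of_ae hb
  have hcl : t ∈ closure (Ioo 0 T ∩ {t | t ∈ Icc (0:ℝ) T → (∀ x, |v t x| ≤ C) ∧
      LipschitzWith C.toNNReal (v t) ∧ SemiconcaveWith d C (v t)}) := by
    have h1 := closure_mono (hd.open_subset_closure_inter (isOpen_Ioo (a := (0:ℝ)) (b := T)))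
    rw [closure_closure, closure_Ioo hT.ne] at h1
    exact h1 ht
  rw [mem_closure_iff_nhdsWithin_neBot] at hcl
  set S := (Ioo 0 T ∩ {t | t ∈ Icc (0:ℝ) T → (∀ x, |v t x| ≤ C) ∧
      LipschitzWith C.toNNReal (v t) ∧ SemiconcaveWith d C (v t)}) with hS
  have hlim : ∀ x, Tendsto (fun t => v t x) (𝓝[S] t) (𝓝 (v t x)) := fun x =>
    ((hc x) t ht).mono_left (nhdsWithin_mono _ (inter_subset_left.trans Ioo_subset_Icc_self))
  have hgood : ∀ᶠ s in 𝓝[S] t, (∀ x, |v s x| ≤ C) ∧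
      LipschitzWith C.toNNReal (v s) ∧ SemiconcaveWith d C (v s) := by
    filter_upwards [self_mem_nhdsWithin] with s hs
    exact hs.2 (Ioo_subset_Icc_self hs.1)
  refine ⟨fun x => ?_, ?_, ?_⟩
  · exact le_of_tendsto (hlim x).abs (hgood.mono fun s hs => hs.1 x)
  · refine LipschitzWith.of_le_add_mul _ fun x y => ?_
    exact le_of_tendsto_of_tendsto (hlim x) ((hlim y).add_const _)
      (hgood.mono fun s hs => hs.2.1.le_add_mul x y)
  · intro x y θ h0 h1
    exact le_of_tendsto ((((hlim x).const_mul θ).add ((hlim y).const_mul (1 - θ))).sub (hlim _))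
      (hgood.mono fun s hs => hs.2.2 x y θ h0 h1)

lemma aux_floor_tendsto {s : ℝ} (hs : 0 ≤ s) {h : ℕ → ℝ} (hp : ∀ n, 0 < h n)
    (h0 : Tendsto h atTop (𝓝 0)) : Tendsto (fun n => (⌊s / h n⌋₊ : ℝ) * h n) atTop (𝓝 s) := by
  have h1 : Tendsto (fun n => s - h n) atTop (𝓝 s) := by simpa using h0.const_sub s
  refine tendsto_of_tendsto_of_tendsto_of_le_of_le h1 tendsto_const_nhds ?_ ?_
  · intro n
    have := (Nat.lt_floor_add_one (s / h n)).le
    rw [div_le_iff₀ (hp n)] at this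
    simp only
    linarith
  · intro n
    have := Nat.floor_le (div_nonneg hs (hp n).le)
    rw [le_div_iff₀ (hp n)] at this
    exact this

set_option maxHeartbeats 1000000 in
lemma aux_fields {Ω : Type*} [mΩ : MeasurableSpace Ω] {T : ℝ} (hT : 0 < T) {μ : Measure Ω}
    {F : Filtration ℝ mΩ} {H : ℝ → V → V → Ω → ℝ} {G : V → Ω → ℝ}
    (h1 : H1Hyp d μ F T H G) (h2 : H2Hyp d T H) {u M : ℝ → V → Ω → ℝ} (hu : HJReg d μ F T u M) :
    ∃ (K c : ℝ) (h : ℕ → ℝ) (β : ℕ → ℕ → Ω → V → V), 0 ≤ K ∧ 0 ≤ c ∧ (∀ N, 0 < h N) ∧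
      Tendsto h atTop (𝓝 0) ∧
      (∀ (N k : ℕ) (t : ℝ), t ∈ Icc (0:ℝ) T → (k:ℝ) * h N ≤ t →
        @Measurable (Ω × V) V (@Prod.instMeasurableSpace Ω V (F t) _) _ fun q => β N k q.1 q.2) ∧
      (∀ N k ω x, ‖β N k ω x‖ ≤ K) ∧
      (∀ N k ω, Continuous (β N k ω)) ∧
      (∀ N k ω (f : V → ℝ≥0∞), ∫⁻ x, f (x - h N • β N k ω x) ≤ ENNReal.ofReal (1 + c * h N) * ∫⁻ x, f x) ∧
      (∀ᵐ ω ∂μ, ∀ s ∈ Icc (0:ℝ) T, ∀ᵐ x ∂(volume : Measure V),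
        Tendsto (fun N => β N ⌊s / h N⌋₊ ω x) atTop
          (𝓝 (gradient (fun p : V => H s p x ω) (gradient (fun y : V => u s y ω) x)))) := by
  obtain ⟨C, hC, hbdd⟩ := hu.bdd
  obtain ⟨-, -, hH2, hHad, hHc⟩ := h1
  obtain ⟨hconv, hHb, -⟩ := h2
  obtain ⟨K, hK, hKb⟩ := hHb C hC
  have hb3 : ∀ t ∈ Icc (0:ℝ) T, ∀ ω : Ω, ∀ p x : V, ‖p‖ ≤ C → ‖fderiv ℝ (fun q : V => H t q x ω) p‖ ≤ K ∧
        ‖fderiv ℝ (fun y : V => fderiv ℝ (fun q : V => H t q y ω) p) x‖ ≤ K ∧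
        ‖iteratedFDeriv ℝ 2 (fun q : V => H t q x ω) p‖ ≤ K := by
    intro t ht ω p x hp
    have := hKb t ht ω p x hp
    have a1 := abs_nonneg (H t p x ω)
    have a2 := norm_nonneg (fderiv ℝ (fun q : V => H t q x ω) p)
    have a3 : 0 ≤ ‖fderiv ℝ (fun y : V => fderiv ℝ (fun q : V => H t q y ω) p) x‖ :=
      ContinuousLinearMap.opNorm_nonneg _
    have a4 : 0 ≤ ‖iteratedFDeriv ℝ 2 (fun q : V => H t q x ω) p‖ := norm_nonneg _
    refine ⟨?_, ?_, ?_⟩ <;> linarith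
  choose L hL0 hL using fun N => auxMol_D2 (d := d) N C
  set c0 : ℝ := d * (K * C) + d * K with hc0
  have hc0n : 0 ≤ c0 := by positivity
  choose h0 hh0 hdet using fun N => aux_det (d := d) (K * L N + K) c0
  set h : ℕ → ℝ := fun N => min (min (h0 N) (1 / ((N:ℝ) + 1)))
    (min (1 / ((K * L N + K) + 1)) (1 / (2 * (c0 + 1)))) with hhdef
  have hpos : ∀ N, 0 < h N := by
    intro N
    have := hL0 N
    have := hh0 N
    simp only [hhdef, lt_min_iff]
    refine ⟨⟨hh0 N, by positivity⟩, by positivity, by positivity⟩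
  have hle0 : ∀ N, h N ≤ h0 N := fun N => (min_le_left _ _).trans (min_le_left _ _)
  have hle1 : ∀ N, h N ≤ 1 / ((N:ℝ) + 1) := fun N => (min_le_left _ _).trans (min_le_right _ _)
  have hle2 : ∀ N, h N ≤ 1 / ((K * L N + K) + 1) := fun N => (min_le_right _ _).trans (min_le_left _ _)
  have hle3 : ∀ N, h N ≤ 1 / (2 * (c0 + 1)) := fun N => (min_le_right _ _).trans (min_le_right _ _)
  have hlim : Tendsto h atTop (𝓝 0) :=
    squeeze_zero (fun N => (hpos N).le) hle1 tendsto_one_div_add_atTop_nhds_zero_nat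
  clear_value h
  let w : ℝ → Ω → ℕ → ℝ := fun t ω n => u t (TopologicalSpace.denseSeq V n) ω
  let τ : ℕ → ℕ → ℝ := fun N k => min ((k:ℝ) * h N) T
  have hτ : ∀ N k, τ N k ∈ Icc (0:ℝ) T := fun N k =>
    ⟨le_min (mul_nonneg (Nat.cast_nonneg _) (hpos N).le) hT.le, min_le_right _ _⟩
  let f : ℕ → ℕ → Ω → V → ℝ := fun N k ω => auxV C (w (τ N k) ω)
  have hfc : ∀ N k ω, Continuous (f N k ω) := fun N k ω => (auxV_lip hC.le _).continuous
  let β : ℕ → ℕ → Ω → V → V := fun N k ω x =>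
    auxGr (fun p x => H (τ N k) p x ω) (gradient (auxMol N (f N k ω)) x) x
  have hmolR : ∀ N k ω x, ‖fderiv ℝ (auxMol N (f N k ω)) x‖ ≤ C := by
    intro N k ω x
    have := norm_fderiv_le_of_lipschitz ℝ (x₀ := x) (auxMol_lip N (auxV_lip hC.le (w (τ N k) ω)))
    rwa [Real.coe_toNNReal _ hC.le] at this
  have hfield := fun N k ω => aux_field (h := fun p x => H (τ N k) p x ω) (hH2 ω (τ N k))
    (fun x => hconv (τ N k) (hτ N k) ω x) hC.le (hb3 (τ N k) (hτ N k) ω)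
    (auxMol_contDiff N (hfc N k ω)) (hmolR N k ω) (hL N (f N k ω) (hfc N k ω) (auxV_abs hC.le _))
    (auxMol_semiconcave N (hfc N k ω) (auxV_semi hC.le _))
  refine ⟨K, 2 * (c0 + 1), h, β, hK.le, by positivity, hpos, hlim, ?_, fun N k ω x => (hfield N k ω).2.1 x,
    fun N k ω => (hfield N k ω).1, ?_, ?_⟩
  · intro N k t ht hkt
    have hle : F (τ N k) ≤ F t := F.mono ((min_le_left _ _).trans hkt)
    have hum : ∀ x, @Measurable Ω ℝ (F t) _ (fun ω => u (τ N k) x ω) := fun x =>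
      (hu.adapted_u x (τ N k)).mono hle le_rfl
    have hHm : ∀ p x, @Measurable Ω ℝ (F t) _ (fun ω => H (τ N k) p x ω) := fun p x =>
      (hHad p x (τ N k)).mono hle le_rfl
    have hfm : ∀ x, @Measurable Ω ℝ (F t) _ (fun ω => f N k ω x) := by
      intro x
      have hw : @Measurable Ω (ℕ → ℝ) (F t) _ (fun ω => w (τ N k) ω) :=
        @measurable_pi_lambda Ω ℕ (fun _ => ℝ) (F t) _ _ (fun n => hum _)
      exact (auxV_meas hC.le x).comp hw
    exact @aux_field_meas d Ω (F t) N (f N k) hfm (hfc N k) (fun ω p x => H (τ N k) p x ω)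
      (fun ω => hH2 ω (τ N k)) hHm
  · intro N k ω g
    obtain ⟨β', hβ'⟩ := (hfield N k ω).2.2
    have hLL : 0 ≤ K * L N + K := by have := hL0 N; positivity
    have := aux_push (L := K * L N + K) (c := c0 + 1) (h := h N) hLL (fun x => (hβ' x).1)
      (fun x => (hβ' x).2.1) (hpos N).le ?_ (by positivity) ?_ ?_ g
    · refine this.trans (le_of_eq ?_)
      rfl
    · have := (le_div_iff₀ (by positivity)).1 (hle2 N)
      have := hpos N
      nlinarith
    · have := (le_div_iff₀ (by positivity)).1 (hle3 N)
      nlinarith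
    · intro x
      exact hdet N (h N) (hpos N).le (hle0 N) _ (hβ' x).2.1 (hβ' x).2.2
  · filter_upwards [hu.cont_u, hbdd] with ω hcu hbω
    have hall := aux_all_t hT (v := fun t x => u t x ω) hcu (hbω.mono fun t ht =>
      ⟨fun x => (ht.1 x).1, ht.2.1, ht.2.2⟩)
    intro s hs
    have hfl : ∀ N, (⌊s / h N⌋₊ : ℝ) * h N ≤ s := fun N => by
      have := Nat.floor_le (div_nonneg hs.1 (hpos N).le)
      rwa [le_div_iff₀ (hpos N)] at this
    have hτe : ∀ N, τ N ⌊s / h N⌋₊ = (⌊s / h N⌋₊ : ℝ) * h N := fun N =>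
      min_eq_left ((hfl N).trans hs.2)
    have hτl : Tendsto (fun N => τ N ⌊s / h N⌋₊) atTop (𝓝 s) := by
      simp only [hτe]
      exact aux_floor_tendsto hs.1 hpos hlim
    have hfe : ∀ N k, f N k ω = fun x => u (τ N k) x ω := by
      intro N k
      have := hall (τ N k) (hτ N k)
      exact auxV_eq (f := fun x => u (τ N k) x ω) hC.le this.2.1 this.1 this.2.2
    have hdiff := (hall s hs).2.1.ae_differentiableAt (μ := volume)
    filter_upwards [hdiff] with x hx
    refine aux_grad_convex (k := fun N p => H (τ N ⌊s / h N⌋₊) p x ω)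
      (p := fun N => gradient (auxMol N (f N ⌊s / h N⌋₊ ω)) x) (fun N => hconv _ (hτ _ _) ω x)
      (fun N => ((hH2 ω _).comp (contDiff_id.prodMk contDiff_const)).differentiable (by norm_num)) ?_ ?_ ?_ ?_
    · intro R
      obtain ⟨K', -, hK'⟩ := hHb (max R 1) (by positivity)
      refine ⟨K', fun N q hq => ?_⟩
      have := hK' _ (hτ N ⌊s / h N⌋₊) ω q x (hq.trans (le_max_left _ _))
      have a1 := abs_nonneg (H (τ N ⌊s / h N⌋₊) q x ω)
      have a3 : 0 ≤ ‖fderiv ℝ (fun y : V => fderiv ℝ (fun q : V => H (τ N ⌊s / h N⌋₊) q y ω) q) x‖ :=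
        ContinuousLinearMap.opNorm_nonneg _
      have a4 : 0 ≤ ‖iteratedFDeriv ℝ 2 (fun q : V => H (τ N ⌊s / h N⌋₊) q x ω) q‖ := norm_nonneg _
      linarith
    · intro q
      exact ((hHc q x ω).tendsto s).comp hτl
    · exact ((hH2 ω s).comp (contDiff_id.prodMk contDiff_const)).differentiable (by norm_num) _
    · refine aux_grad_lim (C := C) (f := fun N => auxMol N (f N ⌊s / h N⌋₊ ω)) (f0 := fun y => u s y ω)
        (fun N => auxMol_semiconcave N (hfc _ _ _) (auxV_semi hC.le _))
        (fun N => (auxMol_contDiff N (hfc _ _ _)).differentiable (by norm_num) x) ?_ hx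
      intro y
      have e1 : Tendsto (fun N => u (τ N ⌊s / h N⌋₊) y ω) atTop (𝓝 (u s y ω)) := by
        have := hcu y s hs
        exact this.tendsto.comp (tendsto_nhdsWithin_iff.2 ⟨hτl, Eventually.of_forall fun N => hτ _ _⟩)
      have e2 : Tendsto (fun N => auxMol N (f N ⌊s / h N⌋₊ ω) y - u (τ N ⌊s / h N⌋₊) y ω) atTop (𝓝 0) := by
        refine squeeze_zero_norm (a := fun N : ℕ => C / ((N:ℝ) + 1)) (fun N => ?_) ?_
        · have := auxMol_close N hC.le (auxV_lip (d := d) hC.le (w (τ N ⌊s / h N⌋₊) ω)) y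
          have e := congrFun (hfe N ⌊s / h N⌋₊) y
          change auxV C (w (τ N ⌊s / h N⌋₊) ω) y = u (τ N ⌊s / h N⌋₊) y ω at e
          rw [e] at this
          exact this
        · have := (tendsto_one_div_add_atTop_nhds_zero_nat (𝕜 := ℝ)).const_mul C
          simpa [div_eq_mul_inv] using this
      simpa using e2.add e1

def auxY (h : ℝ) (β : ℕ → V → V) : ℕ → V → V
  | 0 => fun x => x
  | k + 1 => fun x => auxY h β k x - h • β k (auxY h β k x)

lemma auxY_step {h K : ℝ} (hh : 0 ≤ h) {β : ℕ → V → V} (hβ : ∀ k x, ‖β k x‖ ≤ K) (j n : ℕ) (x : V) :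
    ‖auxY h β (j + n) x - auxY h β j x‖ ≤ K * (h * n) := by
  induction n with
  | zero => simp
  | succ n ih =>
    have e : auxY h β (j + (n + 1)) x - auxY h β j x =
        (auxY h β (j + n) x - auxY h β j x) - h • β (j + n) (auxY h β (j + n) x) := by
      rw [← add_assoc]; simp only [auxY]; abel
    rw [e]
    refine (norm_sub_le _ _).trans ?_
    rw [norm_smul, Real.norm_of_nonneg hh]
    have := mul_le_mul_of_nonneg_left (hβ (j + n) (auxY h β (j + n) x)) hh
    push_cast
    nlinarith

lemma auxY_cont {h : ℝ} {β : ℕ → V → V} (hβ : ∀ k, Continuous (β k)) (k : ℕ) : Continuous (auxY h β k) := by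
  induction k with
  | zero => exact continuous_id
  | succ k ih => exact ih.sub (((hβ k).comp ih).const_smul h)

lemma auxY_push {h : ℝ} {Λ : ℝ≥0∞} {β : ℕ → V → V}
    (hp : ∀ k (f : V → ℝ≥0∞), ∫⁻ x, f (x - h • β k x) ≤ Λ * ∫⁻ x, f x) (k : ℕ) :
    ∀ f : V → ℝ≥0∞, ∫⁻ x, f (auxY h β k x) ≤ Λ ^ k * ∫⁻ x, f x := by
  induction k with
  | zero => intro f; simp [auxY]
  | succ k ih =>
    intro f
    refine (ih fun y => f (y - h • β k y)).trans ?_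
    rw [pow_succ, mul_assoc]
    exact mul_le_mul_right (hp k f) _

lemma auxY_meas {α : Type*} [MeasurableSpace α] {h : ℝ} {β : ℕ → α → V → V} (k : ℕ)
    (hβ : ∀ j < k, Measurable fun q : α × V => β j q.1 q.2) :
    Measurable fun q : α × V => auxY h (fun j => β j q.1) k q.2 := by
  induction k with
  | zero => exact measurable_snd
  | succ k ih =>
    have h1 := ih fun j hj => hβ j (hj.trans (Nat.lt_succ_self k))
    have h2 := (hβ k (Nat.lt_succ_self k)).comp (measurable_fst.prodMk h1)
    exact h1.sub (h2.const_smul h)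

/-- bounded densities with a first moment bound -/
structure AuxDens (d : ℕ) (Λ M : ℝ) (r : EuclideanSpace ℝ (Fin d) → ℝ) : Prop where
  meas : Measurable r
  nonneg : ∀ x, 0 ≤ r x
  le : ∀ x, r x ≤ Λ
  integrable : Integrable r
  mass : ∫ x, r x = 1
  integrable_mom : Integrable fun x => ‖x‖ * r x
  mom : ∫ x, ‖x‖ * r x ≤ M

lemma auxDens_push {ρ0 : V → ℝ} {R m Λ B : ℝ} (h0 : AuxDens d R m ρ0) (hΛ : 0 ≤ Λ)
    {Y : V → V} (hY : Measurable Y) (hp : ∀ f : V → ℝ≥0∞, ∫⁻ x, f (Y x) ≤ ENNReal.ofReal Λ * ∫⁻ x, f x)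
    (hB : ∀ x, ‖Y x‖ ≤ ‖x‖ + B) :
    ∃ r, AuxDens d (R * Λ) (m + B) r ∧ ∀ φ : V → ℝ, Measurable φ →
      ∫ x, φ (Y x) * ρ0 x = ∫ x, φ x * r x := by
  have hR : 0 ≤ R := (h0.nonneg 0).trans (h0.le 0)
  set m0 : Measure V := volume.withDensity fun x => ENNReal.ofReal (ρ0 x) with hm0
  set ν : Measure V := m0.map Y with hν
  have hm0mass : m0 univ = 1 := by
    rw [hm0, withDensity_apply _ MeasurableSet.univ, Measure.restrict_univ,
      ← ofReal_integral_eq_lintegral_ofReal h0.integrable (ae_of_all _ h0.nonneg), h0.mass]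
    simp
  have : IsProbabilityMeasure m0 := ⟨hm0mass⟩
  have : IsProbabilityMeasure ν := Measure.isProbabilityMeasure_map hY.aemeasurable
  have hle : ν ≤ ENNReal.ofReal (R * Λ) • volume := by
    refine Measure.le_iff.2 fun A hA => ?_
    rw [hν, Measure.map_apply hY hA, hm0, withDensity_apply _ (hY hA), Measure.smul_apply, smul_eq_mul]
    calc ∫⁻ x in Y ⁻¹' A, ENNReal.ofReal (ρ0 x) ≤ ∫⁻ x in Y ⁻¹' A, ENNReal.ofReal R :=
          lintegral_mono fun x => ENNReal.ofReal_le_ofReal (h0.le x)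
      _ = ENNReal.ofReal R * volume (Y ⁻¹' A) := by rw [setLIntegral_const]
      _ = ENNReal.ofReal R * ∫⁻ x, A.indicator 1 (Y x) := by
          congr 1
          rw [← lintegral_indicator_one (hY hA)]
          rfl
      _ ≤ ENNReal.ofReal R * (ENNReal.ofReal Λ * ∫⁻ x, A.indicator 1 x) :=
          mul_le_mul_right (hp _) _
      _ = _ := by rw [lintegral_indicator_one hA, ENNReal.ofReal_mul hR, mul_assoc]
  have hac : ν ≪ volume := (Measure.absolutelyContinuous_of_le hle).trans Measure.smul_absolutelyContinuous
  set g := ν.rnDeriv volume with hg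
  have hgm : Measurable g := Measure.measurable_rnDeriv _ _
  have hgν : volume.withDensity g = ν := Measure.withDensity_rnDeriv_eq _ _ hac
  have hgle : ∀ᵐ x, g x ≤ ENNReal.ofReal (R * Λ) := by
    refine ae_le_of_forall_setLIntegral_le_of_sigmaFinite hgm fun A hA _ => ?_
    rw [setLIntegral_const, ← withDensity_apply _ hA, hgν]
    exact hle A
  set r : V → ℝ := fun x => (min (g x) (ENNReal.ofReal (R * Λ))).toReal with hr
  have hrm : Measurable r := (hgm.min measurable_const).ennreal_toReal
  have hrg : ∀ᵐ x, ENNReal.ofReal (r x) = g x := by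
    filter_upwards [hgle] with x hx
    simp only [hr]
    rw [ENNReal.ofReal_toReal (ne_top_of_le_ne_top ENNReal.ofReal_ne_top (min_le_right _ _)), min_eq_left hx]
  have hlint : ∀ f : V → ℝ≥0∞, Measurable f →
      ∫⁻ x, f (Y x) * ENNReal.ofReal (ρ0 x) = ∫⁻ x, f x * ENNReal.ofReal (r x) := by
    intro f hf
    have e1 : ∫⁻ x, f x ∂ν = ∫⁻ x, f x * ENNReal.ofReal (r x) := by
      rw [← hgν, lintegral_withDensity_eq_lintegral_mul _ hgm hf]
      refine lintegral_congr_ae ?_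
      filter_upwards [hrg] with x hx
      simp [hx, mul_comm]
    have e2 : ∫⁻ x, f x ∂ν = ∫⁻ x, f (Y x) * ENNReal.ofReal (ρ0 x) := by
      rw [hν, lintegral_map hf hY, hm0, lintegral_withDensity_eq_lintegral_mul _
        h0.meas.ennreal_ofReal (g := fun x => f (Y x)) (hf.comp hY)]
      refine lintegral_congr fun x => ?_
      simp [mul_comm]
    rw [← e1, e2]
  have hrn : ∀ x, 0 ≤ r x := fun x => ENNReal.toReal_nonneg
  have hRΛ : 0 ≤ R * Λ := mul_nonneg hR hΛ
  have hrle : ∀ x, r x ≤ R * Λ := fun x => ENNReal.toReal_le_of_le_ofReal hRΛ (min_le_right _ _)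
  have hmass : ∫⁻ x, ENNReal.ofReal (r x) = 1 := by
    have := hlint 1 measurable_one
    simp only [Pi.one_apply, one_mul] at this
    rw [← this, ← ofReal_integral_eq_lintegral_ofReal h0.integrable (ae_of_all _ h0.nonneg), h0.mass]
    simp
  have hrint : Integrable r := by
    refine ⟨hrm.aestronglyMeasurable, ?_⟩
    rw [hasFiniteIntegral_iff_ofReal (ae_of_all _ hrn), hmass]
    simp
  have hmom : ∫⁻ x, ENNReal.ofReal (‖x‖ * r x) ≤ ENNReal.ofReal (m + B) := by
    have e := hlint (fun x => ENNReal.ofReal ‖x‖) measurable_norm.ennreal_ofReal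
    have e2 : ∫⁻ x, ENNReal.ofReal (‖x‖ * r x) = ∫⁻ x, ENNReal.ofReal (‖Y x‖ * ρ0 x) := by
      simp only [ENNReal.ofReal_mul (norm_nonneg _)]
      rw [e]
    rw [e2]
    have hi : Integrable fun x => ‖x‖ * ρ0 x + B * ρ0 x :=
      h0.integrable_mom.add (h0.integrable.const_mul B)
    have e3 : ∫ x, (‖x‖ * ρ0 x + B * ρ0 x) ≤ m + B := by
      rw [integral_add h0.integrable_mom (h0.integrable.const_mul B), integral_const_mul, h0.mass]
      linarith [h0.mom]
    have hpt : ∀ x, ‖Y x‖ * ρ0 x ≤ ‖x‖ * ρ0 x + B * ρ0 x := fun x => by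
      rw [← add_mul]; exact mul_le_mul_of_nonneg_right (hB x) (h0.nonneg x)
    calc ∫⁻ x, ENNReal.ofReal (‖Y x‖ * ρ0 x) ≤ ∫⁻ x, ENNReal.ofReal (‖x‖ * ρ0 x + B * ρ0 x) :=
          lintegral_mono fun x => ENNReal.ofReal_le_ofReal (hpt x)
      _ = ENNReal.ofReal (∫ x, (‖x‖ * ρ0 x + B * ρ0 x)) := by
          rw [ofReal_integral_eq_lintegral_ofReal hi]
          exact ae_of_all _ fun x => (mul_nonneg (norm_nonneg _) (h0.nonneg x)).trans (hpt x)
      _ ≤ _ := ENNReal.ofReal_le_ofReal e3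
  have hmB : 0 ≤ m + B := by
    have hi : Integrable fun x => ‖x‖ * ρ0 x + B * ρ0 x :=
      h0.integrable_mom.add (h0.integrable.const_mul B)
    have e3 : ∫ x, (‖x‖ * ρ0 x + B * ρ0 x) ≤ m + B := by
      rw [integral_add h0.integrable_mom (h0.integrable.const_mul B), integral_const_mul, h0.mass]
      linarith [h0.mom]
    refine le_trans (integral_nonneg fun x => ?_) e3
    simp only [Pi.zero_apply]
    rw [← add_mul]
    exact mul_nonneg ((norm_nonneg _).trans (hB x)) (h0.nonneg x)
  have hmn : ∀ x : V, 0 ≤ ‖x‖ * r x := fun x => mul_nonneg (norm_nonneg _) (hrn x)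
  have hmomint : Integrable fun x => ‖x‖ * r x := by
    refine ⟨(measurable_norm.mul hrm).aestronglyMeasurable, ?_⟩
    rw [hasFiniteIntegral_iff_ofReal (ae_of_all _ hmn)]
    exact hmom.trans_lt ENNReal.ofReal_lt_top
  refine ⟨r, ⟨hrm, hrn, hrle, hrint, ?_, hmomint, ?_⟩, ?_⟩
  · rw [integral_eq_lintegral_of_nonneg_ae (ae_of_all _ hrn) hrm.aestronglyMeasurable, hmass]; simp
  · rw [integral_eq_lintegral_of_nonneg_ae (ae_of_all _ hmn) hmomint.1]
    exact ENNReal.toReal_le_of_le_ofReal hmB hmom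
  · intro φ hφ
    have e1 : ∫ x, φ x ∂ν = ∫ x, φ (Y x) * ρ0 x := by
      rw [hν, integral_map hY.aemeasurable hφ.aestronglyMeasurable, hm0,
        integral_withDensity_eq_integral_toReal_smul h0.meas.ennreal_ofReal (ae_of_all _ fun x => ENNReal.ofReal_lt_top)]
      refine integral_congr_ae (ae_of_all _ fun x => ?_)
      simp [ENNReal.toReal_ofReal (h0.nonneg x), mul_comm]
    have e2 : ∫ x, φ x ∂ν = ∫ x, φ x * r x := by
      have e3 : volume.withDensity (fun x => ENNReal.ofReal (r x)) = ν := by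
        rw [← hgν]; exact withDensity_congr_ae hrg
      rw [← e3, integral_withDensity_eq_integral_toReal_smul hrm.ennreal_ofReal
        (ae_of_all _ fun x => ENNReal.ofReal_lt_top)]
      refine integral_congr_ae (ae_of_all _ fun x => ?_)
      simp [ENNReal.toReal_ofReal (hrn x), mul_comm]
    rw [← e1, e2]

lemma aux_floor_cell {h : ℝ} (hh : 0 < h) (j : ℕ) {s : ℝ} (hs : s ∈ Ico ((j:ℝ) * h) ((j + 1 : ℕ) * h)) :
    ⌊s / h⌋₊ = j := by
  have h0 : 0 ≤ s := le_trans (by positivity) hs.1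
  rw [Nat.floor_eq_iff (div_nonneg h0 hh.le)]
  refine ⟨(le_div_iff₀ hh).2 hs.1, (div_lt_iff₀ hh).2 ?_⟩
  have := hs.2
  push_cast at this
  exact this

lemma aux_cell_ae {h : ℝ} (hh : 0 < h) (g : ℕ → ℝ) (j : ℕ) :
    ∀ᵐ s, s ∈ Ioc ((j:ℝ) * h) ((j + 1 : ℕ) * h) → g ⌊s / h⌋₊ = g j := by
  have : ∀ᵐ s : ℝ, s ≠ ((j + 1 : ℕ) : ℝ) * h := by
    simp [ae_iff]
  filter_upwards [this] with s hs hm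
  rw [aux_floor_cell hh j ⟨hm.1.le, lt_of_le_of_ne hm.2 hs⟩]

lemma aux_cell_int {h : ℝ} (hh : 0 < h) (g : ℕ → ℝ) (k : ℕ) :
    ∫ s in (0:ℝ)..(k * h), g ⌊s / h⌋₊ = ∑ j ∈ Finset.range k, h * g j := by
  have hlt : ∀ j : ℕ, (j:ℝ) * h ≤ ((j + 1 : ℕ) : ℝ) * h := fun j => by push_cast; nlinarith
  have h1 := intervalIntegral.sum_integral_adjacent_intervals (f := fun s => g ⌊s / h⌋₊) (μ := volume)
    (a := fun j : ℕ => (j:ℝ) * h) (n := k) (fun j _ => by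
      have : IntervalIntegrable (fun _ : ℝ => g j) volume ((j:ℝ) * h) (((j + 1 : ℕ) : ℝ) * h) :=
        intervalIntegrable_const
      refine this.congr_ae ?_
      rw [uIoc_of_le (hlt j)]
      refine (ae_restrict_iff' measurableSet_Ioc).2 ?_
      filter_upwards [aux_cell_ae hh g j] with s hs hm
      exact (hs hm).symm)
  simp only [Nat.cast_zero, zero_mul] at h1
  rw [← h1]
  refine Finset.sum_congr rfl fun j _ => ?_
  rw [intervalIntegral.integral_congr_ae (g := fun _ => g j)]
  · simp only [intervalIntegral.integral_const, smul_eq_mul]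
    push_cast; ring
  · rw [uIoc_of_le (hlt j)]
    exact aux_cell_ae hh g j

lemma aux_floor_meas (h : ℝ) (g : ℕ → ℝ) : Measurable fun s : ℝ => g ⌊s / h⌋₊ :=
  (measurable_of_countable g).comp (Nat.measurable_floor.comp (measurable_id.div_const h))

lemma aux_discrete {h E B : ℝ} (hh : 0 < h) {a g : ℕ → ℝ}
    (hE : ∀ j, |a (j + 1) - a j + h * g j| ≤ E * h ^ 2) (hB : ∀ j, |g j| ≤ B) {t : ℝ} (ht : 0 ≤ t) :
    |a ⌊t / h⌋₊ - a 0 + ∫ s in Ioc 0 t, g ⌊s / h⌋₊| ≤ (E * t + B) * h := by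
  have hE0 : 0 ≤ E := by
    have := (abs_nonneg _).trans (hE 0)
    by_contra hcon
    push Not at hcon
    have : E * h ^ 2 < 0 := by have := sq_pos_of_pos hh; nlinarith
    linarith
  have hsum : ∀ k : ℕ, |a k - a 0 + ∑ j ∈ Finset.range k, h * g j| ≤ E * h ^ 2 * k := by
    intro k
    induction k with
    | zero => simp
    | succ k ih =>
      rw [Finset.sum_range_succ]
      have e : a (k + 1) - a 0 + (∑ j ∈ Finset.range k, h * g j + h * g k) =
        (a k - a 0 + ∑ j ∈ Finset.range k, h * g j) + (a (k + 1) - a k + h * g k) := by ring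
      rw [e]
      refine (abs_add_le _ _).trans ?_
      have := hE k
      push_cast
      linarith
  set k := ⌊t / h⌋₊ with hk
  have hkt : (k:ℝ) * h ≤ t := by
    have := Nat.floor_le (div_nonneg ht hh.le)
    rwa [le_div_iff₀ hh] at this
  have htk : t - k * h ≤ h := by
    have := (Nat.lt_floor_add_one (t / h)).le
    rw [div_le_iff₀ hh] at this
    linarith
  have hbi : ∀ a b : ℝ, IntervalIntegrable (fun s => g ⌊s / h⌋₊) volume a b := by
    intro a b
    refine (intervalIntegrable_const (c := B)).mono_fun (aux_floor_meas h g).aestronglyMeasurable ?_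
    refine ae_of_all _ fun s => ?_
    exact (hB _).trans (le_abs_self _)
  rw [← intervalIntegral.integral_of_le ht,
    ← intervalIntegral.integral_add_adjacent_intervals (hbi 0 (k * h)) (hbi (k * h) t), aux_cell_int hh]
  have h2 : |∫ s in (k * h)..t, g ⌊s / h⌋₊| ≤ B * |t - k * h| := by
    have := intervalIntegral.norm_integral_le_of_norm_le_const (a := k * h) (b := t) (C := B)
      (f := fun s => g ⌊s / h⌋₊) (fun s _ => hB _)
    exact this
  rw [abs_of_nonneg (show 0 ≤ t - k * h by linarith)] at h2
  have hB0 : 0 ≤ B := (abs_nonneg _).trans (hB 0)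
  have h3 : B * (t - k * h) ≤ B * h := mul_le_mul_of_nonneg_left htk hB0
  have h4 : E * h ^ 2 * k ≤ E * t * h := by
    have := mul_le_mul_of_nonneg_left hkt (mul_nonneg hE0 hh.le)
    nlinarith
  rw [← add_assoc]
  refine (abs_add_le _ _).trans ?_
  have := hsum k
  linarith

lemma aux_taylor {φ : V → ℝ} (hφ : ContDiff ℝ (⊤ : ℕ∞) φ) (hc : HasCompactSupport φ) :
    ∃ A : ℝ, 0 ≤ A ∧ (∀ x, ‖gradient φ x‖ ≤ A) ∧ ∀ x v : V, |φ (x + v) - φ x - ⟪gradient φ x, v⟫| ≤ A * ‖v‖ ^ 2 := by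
  have hf1 : ContDiff ℝ 1 (fderiv ℝ φ) := (contDiff_infty.1 hφ 2).fderiv_right (by norm_num)
  have hc1 : HasCompactSupport (fderiv ℝ φ) := hc.fderiv ℝ
  obtain ⟨A1, hA1⟩ := hc1.exists_bound_of_continuous hf1.continuous
  obtain ⟨A2, hA2⟩ := hf1.lipschitzWith_of_hasCompactSupport hc1 (by norm_num)
  have hA10 : 0 ≤ A1 := (norm_nonneg _).trans (hA1 0)
  refine ⟨A1 + A2, by positivity, fun x => ?_, fun x v => ?_⟩
  · rw [aux_norm_grad]
    have := hA1 x
    have : (0:ℝ) ≤ A2 := A2.2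
    linarith
  · rw [aux_inner_grad]
    have hd : Differentiable ℝ φ := hφ.differentiable (by simp)
    have := (convex_segment x (x + v)).norm_image_sub_le_of_norm_fderiv_le' (𝕜 := ℝ) (f := φ)
      (φ := fderiv ℝ φ x) (C := A2 * ‖v‖) (x := x) (y := x + v) (fun y _ => hd y) ?_
      (left_mem_segment ℝ _ _) (right_mem_segment ℝ _ _)
    · rw [add_sub_cancel_left] at this
      rw [Real.norm_eq_abs] at this
      refine this.trans ?_
      nlinarith [norm_nonneg v, mul_nonneg hA10 (sq_nonneg ‖v‖)]
    · intro y hy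
      refine (hA2.norm_sub_le y x).trans ?_
      refine mul_le_mul_of_nonneg_left ?_ A2.2
      rw [segment_eq_image'] at hy
      obtain ⟨θ, hθ, rfl⟩ := hy
      simp only [add_sub_cancel_left, norm_smul, Real.norm_eq_abs, abs_of_nonneg hθ.1]
      exact mul_le_of_le_one_left (norm_nonneg _) hθ.2

lemma aux_euler {φ : V → ℝ} (hφ : ContDiff ℝ (⊤ : ℕ∞) φ) (hc : HasCompactSupport φ) {R m K : ℝ} {ρ0 : V → ℝ}
    (h0 : AuxDens d R m ρ0) : ∃ E B : ℝ, ∀ (h : ℝ) (β : ℕ → V → V), 0 < h → (∀ k x, ‖β k x‖ ≤ K) →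
      (∀ k, Continuous (β k)) → (∀ j, |∫ x, ⟪gradient φ (auxY h β j x), β j (auxY h β j x)⟫ * ρ0 x| ≤ B) ∧
      ∀ t, 0 ≤ t →
      |(∫ x, φ (auxY h β ⌊t / h⌋₊ x) * ρ0 x) - (∫ x, φ x * ρ0 x) +
        ∫ s in Ioc 0 t, ∫ x, ⟪gradient φ (auxY h β ⌊s / h⌋₊ x), β ⌊s / h⌋₊ (auxY h β ⌊s / h⌋₊ x)⟫ * ρ0 x|
        ≤ (E * t + B) * h := by
  obtain ⟨A, hA0, hA1, hA2⟩ := aux_taylor hφ hc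
  refine ⟨A * K ^ 2, A * K, fun h β hh hβ hβc => ?_⟩
  have hK0 : 0 ≤ K := (norm_nonneg _).trans (hβ 0 0)
  have hYc := fun j => auxY_cont (h := h) hβc j
  have hgc : Continuous (gradient φ) := by
    have h1 : ContDiff ℝ 1 (fderiv ℝ φ) := (contDiff_infty.1 hφ 2).fderiv_right (by norm_num)
    exact ((InnerProductSpace.toDual ℝ V).symm.contDiff.comp h1).continuous
  obtain ⟨Cφ, hCφ⟩ := hc.exists_bound_of_continuous hφ.continuous
  have hi1 : ∀ j, Integrable fun x => φ (auxY h β j x) * ρ0 x := fun j =>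
    h0.integrable.bdd_mul (hφ.continuous.comp (hYc j)).aestronglyMeasurable (ae_of_all _ fun x => hCφ _)
  have hptb : ∀ j x, |⟪gradient φ (auxY h β j x), β j (auxY h β j x)⟫| ≤ A * K := fun j x =>
    (abs_real_inner_le_norm _ _).trans (mul_le_mul (hA1 _) (hβ _ _) (norm_nonneg _) hA0)
  have hi2 : ∀ j, Integrable fun x => ⟪gradient φ (auxY h β j x), β j (auxY h β j x)⟫ * ρ0 x := fun j =>
    h0.integrable.bdd_mul (((hgc.comp (hYc j)).inner ((hβc j).comp (hYc j))).aestronglyMeasurable)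
      (ae_of_all _ fun x => hptb j x)
  have bound : ∀ (D : ℝ) (f : V → ℝ), (∀ x, |f x| ≤ D) → |∫ x, f x * ρ0 x| ≤ D := by
    intro D f hf
    have := norm_integral_le_of_norm_le (h0.integrable.const_mul D) (f := fun x => f x * ρ0 x)
      (ae_of_all _ fun x => by
        rw [norm_mul, Real.norm_of_nonneg (h0.nonneg x)]
        exact mul_le_mul_of_nonneg_right (hf x) (h0.nonneg x))
    rw [integral_const_mul, h0.mass, mul_one] at this
    exact this
  have hgB : ∀ j, |∫ x, ⟪gradient φ (auxY h β j x), β j (auxY h β j x)⟫ * ρ0 x| ≤ A * K := fun j =>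
    bound _ _ (hptb j)
  refine ⟨hgB, fun t ht => ?_⟩
  refine aux_discrete hh (a := fun j => ∫ x, φ (auxY h β j x) * ρ0 x)
    (g := fun j => ∫ x, ⟪gradient φ (auxY h β j x), β j (auxY h β j x)⟫ * ρ0 x) ?_ hgB ht
  intro j
  have e : (∫ x, φ (auxY h β (j + 1) x) * ρ0 x) - (∫ x, φ (auxY h β j x) * ρ0 x) +
      h * ∫ x, ⟪gradient φ (auxY h β j x), β j (auxY h β j x)⟫ * ρ0 x =
      ∫ x, (φ (auxY h β (j + 1) x) - φ (auxY h β j x) +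
        h * ⟪gradient φ (auxY h β j x), β j (auxY h β j x)⟫) * ρ0 x := by
    have hi3 : Integrable fun x => φ (auxY h β (j + 1) x) * ρ0 x - φ (auxY h β j x) * ρ0 x :=
      (hi1 _).sub (hi1 _)
    rw [← integral_const_mul, ← integral_sub (hi1 _) (hi1 _), ← integral_add hi3
      ((hi2 j).const_mul h)]
    refine integral_congr_ae (ae_of_all _ fun x => ?_)
    simp only
    ring
  rw [e]
  refine bound _ _ fun x => ?_
  have := hA2 (auxY h β j x) (-(h • β j (auxY h β j x)))
  rw [inner_neg_right, inner_smul_right, norm_neg, norm_smul, Real.norm_of_nonneg hh.le,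
    sub_neg_eq_add, ← sub_eq_add_neg] at this
  refine this.trans ?_
  rw [mul_pow]
  have h5 : ‖β j (auxY h β j x)‖ ^ 2 ≤ K ^ 2 := pow_le_pow_left₀ (norm_nonneg _) (hβ _ _) 2
  calc A * (h ^ 2 * ‖β j (auxY h β j x)‖ ^ 2) ≤ A * (h ^ 2 * K ^ 2) := by gcongr
    _ = A * K ^ 2 * h ^ 2 := by ring

structure AuxW (c : ℕ → (ℕ →₀ ℝ)) : Prop where
  nonneg : ∀ k N, 0 ≤ c k N
  ge : ∀ k N, c k N ≠ 0 → k ≤ N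
  mass : ∀ k, Finsupp.linearCombination ℝ (fun _ : ℕ => (1:ℝ)) (c k) = 1

abbrev auxS {E : Type*} [AddCommGroup E] [Module ℝ E] (a : ℕ →₀ ℝ) (e : ℕ → E) : E :=
  Finsupp.linearCombination ℝ e a

lemma auxS_eq {E : Type*} [AddCommGroup E] [Module ℝ E] (a : ℕ →₀ ℝ) (e : ℕ → E) :
    auxS a e = ∑ N ∈ a.support, a N • e N := by
  rw [auxS, Finsupp.linearCombination_apply, Finsupp.sum]

lemma AuxW.sum {c : ℕ → (ℕ →₀ ℝ)} (hc : AuxW c) (k : ℕ) : ∑ N ∈ (c k).support, c k N = 1 := by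
  have := hc.mass k
  rw [Finsupp.linearCombination_apply, Finsupp.sum] at this
  simpa using this

lemma AuxW.le_sub {E : Type*} [NormedAddCommGroup E] [NormedSpace ℝ E] {c : ℕ → (ℕ →₀ ℝ)}
    (hc : AuxW c) (k : ℕ) (e : ℕ → E) (e0 : E) {ε : ℝ} (h : ∀ N, k ≤ N → ‖e N - e0‖ ≤ ε) :
    ‖auxS (c k) e - e0‖ ≤ ε := by
  have h1 : e0 = ∑ N ∈ (c k).support, c k N • e0 := by
    rw [← Finset.sum_smul, hc.sum, one_smul]
  rw [auxS_eq]
  conv_lhs => rw [h1]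
  rw [← Finset.sum_sub_distrib]
  calc ‖∑ N ∈ (c k).support, (c k N • e N - c k N • e0)‖
      ≤ ∑ N ∈ (c k).support, c k N * ε := by
        refine norm_sum_le_of_le _ fun N hN => ?_
        rw [← smul_sub, norm_smul, Real.norm_of_nonneg (hc.nonneg k N)]
        exact mul_le_mul_of_nonneg_left (h N (hc.ge k N (Finsupp.mem_support_iff.1 hN)))
          (hc.nonneg k N)
    _ = ε := by rw [← Finset.sum_mul, hc.sum, one_mul]

lemma AuxW.tendsto {E : Type*} [NormedAddCommGroup E] [NormedSpace ℝ E] {c : ℕ → (ℕ →₀ ℝ)}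
    (hc : AuxW c) {e : ℕ → E} {e0 : E} (h : Tendsto e atTop (𝓝 e0)) :
    Tendsto (fun k => auxS (c k) e) atTop (𝓝 e0) := by
  rw [Metric.tendsto_atTop] at h ⊢
  intro ε hε
  obtain ⟨n, hn⟩ := h (ε/2) (half_pos hε)
  refine ⟨n, fun k hk => ?_⟩
  rw [dist_eq_norm]
  have := hc.le_sub k e e0 (ε := ε/2) fun N hN => by
    rw [← dist_eq_norm]; exact (hn N (hk.trans hN)).le
  linarith

lemma AuxW.norm_le {E : Type*} [NormedAddCommGroup E] [NormedSpace ℝ E] {c : ℕ → (ℕ →₀ ℝ)}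
    (hc : AuxW c) (k : ℕ) {e : ℕ → E} {B : ℝ} (h : ∀ N, k ≤ N → ‖e N‖ ≤ B) :
    ‖auxS (c k) e‖ ≤ B := by
  have := hc.le_sub k e 0 (ε := B) (by simpa using h)
  simpa using this

lemma AuxW.subseq {c : ℕ → (ℕ →₀ ℝ)} (hc : AuxW c) {ns : ℕ → ℕ} (hn : StrictMono ns) :
    AuxW (fun k => c (ns k)) :=
  ⟨fun k N => hc.nonneg _ N, fun k N h => (hn.id_le k).trans (hc.ge _ N h), fun k => hc.mass _⟩

lemma aux_hilbert {E : Type*} [NormedAddCommGroup E] [InnerProductSpace ℝ E] (f : ℕ → E) (B : ℝ)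
    (hf : ∀ N, ‖f N‖ ≤ B) : ∃ c, AuxW c ∧ CauchySeq fun k => auxS (c k) f := by
  set A : ℕ → Set (ℕ →₀ ℝ) := fun k => {a | (∀ N, 0 ≤ a N) ∧ (∀ N, a N ≠ 0 → k ≤ N) ∧
    Finsupp.linearCombination ℝ (fun _ : ℕ => (1:ℝ)) a = 1} with hA
  have hne : ∀ k, (Finsupp.single k 1) ∈ A k := by
    intro k
    refine ⟨fun N => ?_, fun N hN => ?_, by simp⟩
    · rw [Finsupp.single_apply]; split_ifs <;> norm_num
    · rw [Finsupp.single_apply] at hN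
      by_contra h
      exact hN (if_neg (by omega))
  have hanti : ∀ j k, k ≤ j → A j ⊆ A k := fun j k h a ha =>
    ⟨ha.1, fun N hN => h.trans (ha.2.1 N hN), ha.2.2⟩
  have hmid : ∀ k a b, a ∈ A k → b ∈ A k → (1/2:ℝ) • (a + b) ∈ A k := by
    intro k a b ha hb
    refine ⟨fun N => ?_, fun N hN => ?_, ?_⟩
    · have := ha.1 N; have := hb.1 N
      simp only [Finsupp.smul_apply, Finsupp.add_apply, smul_eq_mul]; positivity
    · by_contra h
      have h1 : a N = 0 := by by_contra h2; exact h (ha.2.1 N h2)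
      have h3 : b N = 0 := by by_contra h2; exact h (hb.2.1 N h2)
      exact hN (by simp [h1, h3])
    · rw [map_smul, map_add, ha.2.2, hb.2.2]; norm_num
  set I : ℕ → Set ℝ := fun k => (fun a => ‖auxS a f‖ ^ 2) '' A k with hI
  have hIne : ∀ k, (I k).Nonempty := fun k => ⟨_, _, hne k, rfl⟩
  have hIb : ∀ k, BddBelow (I k) := fun k => ⟨0, by rintro _ ⟨a, _, rfl⟩; positivity⟩
  set D : ℕ → ℝ := fun k => sInf (I k) with hD
  have hDm : Monotone D := fun k j h => csInf_le_csInf (hIb k) (hIne j) (image_mono (hanti j k h))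
  have hDb : ∀ k, D k ≤ B ^ 2 := by
    intro k
    refine (csInf_le (hIb k) ⟨_, hne k, rfl⟩).trans ?_
    simp only [auxS, Finsupp.linearCombination_single, one_smul]
    exact pow_le_pow_left₀ (norm_nonneg _) (hf k) 2
  have hDt := tendsto_atTop_ciSup hDm ⟨B ^ 2, by rintro _ ⟨k, rfl⟩; exact hDb k⟩
  set L := ⨆ i, D i with hL
  have hDL : ∀ k, D k ≤ L := fun k => hDm.ge_of_tendsto hDt k
  have hch : ∀ k : ℕ, ∃ a ∈ A k, ‖auxS a f‖ ^ 2 < D k + 1 / ((k:ℝ) + 1) := by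
    intro k
    obtain ⟨_, ⟨a, ha, rfl⟩, hlt⟩ := exists_lt_of_csInf_lt (hIne k)
      (show sInf (I k) < D k + 1 / ((k:ℝ) + 1) from lt_add_of_pos_right _ Nat.one_div_pos_of_nat)
    exact ⟨a, ha, hlt⟩
  choose c hcA hcl using hch
  refine ⟨c, ⟨fun k => (hcA k).1, fun k => (hcA k).2.1, fun k => (hcA k).2.2⟩, ?_⟩
  refine cauchySeq_of_le_tendsto_0' (fun k : ℕ => √(2 * (L - D k) + 4 * (1 / ((k:ℝ) + 1)))) ?_ ?_
  · intro k j hkj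
    rw [dist_eq_norm]
    refine Real.le_sqrt_of_sq_le ?_
    have h1 := parallelogram_law_with_norm ℝ (auxS (c k) f) (auxS (c j) f)
    have h2 : D k ≤ ‖auxS ((1/2:ℝ) • (c k + c j)) f‖ ^ 2 :=
      csInf_le (hIb k) ⟨_, hmid k _ _ (hcA k) (hanti j k hkj (hcA j)), rfl⟩
    rw [auxS, map_smul, map_add, norm_smul] at h2
    have h3 := hcl k
    have h4 := hcl j
    have h5 := hDL j
    have h6 : 1 / ((j:ℝ) + 1) ≤ 1 / ((k:ℝ) + 1) := Nat.one_div_le_one_div hkj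
    norm_num [mul_pow] at h2
    simp only [auxS] at *
    nlinarith
  · have : Tendsto (fun k : ℕ => 2 * (L - D k) + 4 * (1 / ((k:ℝ) + 1))) atTop
        (𝓝 (2 * (L - L) + 4 * 0)) :=
      ((tendsto_const_nhds.sub hDt).const_mul 2).add
        (tendsto_one_div_add_atTop_nhds_zero_nat.const_mul 4)
    have h2 := this.sqrt
    simpa using h2

lemma aux_komlos {Ω : Type*} [MeasurableSpace Ω] (μ : Measure Ω) [IsProbabilityMeasure μ]
    (Z : ℕ → ℕ → Ω → ℝ) (B : ℕ → ℝ) (hZ : ∀ N i, Measurable (Z N i))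
    (hB : ∀ N i ω, |Z N i ω| ≤ B i) :
    ∃ c, AuxW c ∧ ∀ᵐ ω ∂μ, ∀ i, ∃ l, Tendsto (fun k => auxS (c k) (fun N => Z N i ω)) atTop (𝓝 l) := by
  set ν : Measure ℕ := (Measure.count : Measure ℕ).toFinite with hν
  have hB0 : ∀ i, 0 < 1 + |B i| := fun i => by positivity
  set f : ℕ → Ω × ℕ → ℝ := fun N q => Z N q.2 q.1 / (1 + |B q.2|) with hf
  have hfm : ∀ N, Measurable (f N) := by
    intro N
    refine measurable_from_prod_countable_left fun i => ?_
    exact (hZ N i).div_const (1 + |B i|)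
  have hfb : ∀ N q, ‖f N q‖ ≤ 1 := by
    intro N q
    rw [Real.norm_eq_abs, hf, abs_div, abs_of_pos (hB0 q.2), div_le_one (hB0 q.2)]
    have := hB N q.2 q.1
    have := le_abs_self (B q.2)
    linarith
  have hmem : ∀ N, MemLp (f N) 2 (μ.prod ν) := fun N =>
    MemLp.of_bound (hfm N).aestronglyMeasurable 1 (Eventually.of_forall (hfb N))
  set g : ℕ → Lp ℝ 2 (μ.prod ν) := fun N => (hmem N).toLp (f N) with hg
  have hgb : ∃ C, ∀ N, ‖g N‖ ≤ C := by
    refine ⟨_, fun N => Lp.norm_le_of_ae_bound (C := 1) zero_le_one ?_⟩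
    filter_upwards [(hmem N).coeFn_toLp] with q hq
    rw [hg, hq]; exact hfb N q
  obtain ⟨C, hC⟩ := hgb
  obtain ⟨c, hc, hcau⟩ := aux_hilbert g C hC
  obtain ⟨G, hG⟩ := cauchySeq_tendsto_of_complete hcau
  obtain ⟨ns, hns, hlim⟩ := (tendstoInMeasure_of_tendsto_Lp hG).exists_seq_tendsto_ae
  refine ⟨fun k => c (ns k), hc.subseq hns, ?_⟩
  have hco : ∀ k, ∀ᵐ q ∂(μ.prod ν), (auxS (c k) g : Lp ℝ 2 (μ.prod ν)) q
      = auxS (c k) (fun N => f N q) := by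
    intro k
    have h1 : ∀ᵐ q ∂(μ.prod ν), ∀ N, (c k N • g N : Lp ℝ 2 (μ.prod ν)) q = c k N • f N q := by
      rw [ae_all_iff]
      intro N
      filter_upwards [Lp.coeFn_smul (c k N) (g N), (hmem N).coeFn_toLp] with q h2 h3
      rw [h2, Pi.smul_apply, hg, h3]
    have h2 : (auxS (c k) g : Lp ℝ 2 (μ.prod ν)) = ∑ N ∈ (c k).support, c k N • g N := auxS_eq _ _
    rw [h2]
    filter_upwards [h1, Lp.coeFn_finsetSum (c k).support (fun N => c k N • g N)] with q h3 h4
    rw [h4, auxS_eq, Finset.sum_apply]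
    exact Finset.sum_congr rfl fun N _ => h3 N
  have hall : ∀ᵐ q ∂(μ.prod ν), ∃ l, Tendsto (fun k => auxS (c (ns k)) (fun N => f N q)) atTop (𝓝 l) := by
    filter_upwards [hlim, ae_all_iff.2 fun k => hco (ns k)] with q h1 h2
    refine ⟨_, h1.congr h2⟩
  filter_upwards [Measure.ae_ae_of_ae_prod hall] with ω hω i
  have h3 : ∀ᵐ i ∂(Measure.count : Measure ℕ), ∃ l, Tendsto (fun k => auxS (c (ns k)) (fun N => f N (ω, i))) atTop (𝓝 l) := by
    rw [← ae_toFinite]; exact hω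
  have h4 := (ae_iff_of_countable.1 h3) i (by simp)
  obtain ⟨l, hl⟩ := h4
  refine ⟨(1 + |B i|) * l, (hl.const_mul (1 + |B i|)).congr fun k => ?_⟩
  rw [auxS_eq, auxS_eq, Finset.mul_sum]
  refine Finset.sum_congr rfl fun N _ => ?_
  have := (hB0 i).ne'
  simp only [hf, smul_eq_mul]
  field_simp

lemma aux_tests : ∃ g : ℕ → V → ℝ,
    (∀ j, Continuous (g j) ∧ HasCompactSupport (g j)) ∧
    ∀ f : V → ℝ, Integrable f → ∀ ε > 0, ∃ j, ∫ x, ‖f x - g j x‖ ≤ ε := by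
  have hfact : Fact ((1:ℝ≥0∞) ≤ 1) := ⟨le_rfl⟩
  have hfact2 : Fact ((1:ℝ≥0∞) ≠ ∞) := ⟨ENNReal.one_ne_top⟩
  have hsec : SecondCountableTopology (Lp ℝ 1 (volume : Measure V)) := Lp.SecondCountableTopology
  set D := TopologicalSpace.denseSeq (Lp ℝ 1 (volume : Measure V)) with hD
  have hch : ∀ j n : ℕ, ∃ g : V → ℝ, HasCompactSupport g ∧ (∫ x, ‖D j x - g x‖) ≤ 1 / ((n:ℝ) + 1) ∧
      Continuous g ∧ Integrable g := fun j n =>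
    (L1.integrable_coeFn (D j)).exists_hasCompactSupport_integral_sub_le Nat.one_div_pos_of_nat
  choose g hg1 hg2 hg3 hg4 using hch
  refine ⟨fun i => g i.unpair.1 i.unpair.2, fun i => ⟨hg3 _ _, hg1 _ _⟩, fun f hf ε hε => ?_⟩
  obtain ⟨n, hn⟩ := exists_nat_one_div_lt (half_pos hε)
  obtain ⟨j, hj⟩ := (TopologicalSpace.denseRange_denseSeq (Lp ℝ 1 (volume : Measure V))).exists_dist_lt
    (hf.toL1 f) (half_pos hε)
  refine ⟨Nat.pair j n, ?_⟩
  simp only [Nat.unpair_pair]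
  rw [dist_eq_norm, L1.norm_eq_integral_norm] at hj
  have h1 : ∫ x, ‖(hf.toL1 f - D j : Lp ℝ 1 (volume : Measure V)) x‖ = ∫ x, ‖f x - D j x‖ := by
    refine integral_congr_ae ?_
    filter_upwards [Lp.coeFn_sub (hf.toL1 f) (D j), hf.coeFn_toL1] with x h2 h3
    rw [h2, Pi.sub_apply, h3]
  have hj' : ∫ x, ‖f x - D j x‖ < ε / 2 := by rw [← h1]; exact hj
  have hi1 : Integrable fun x => ‖f x - D j x‖ := (hf.sub (L1.integrable_coeFn (D j))).norm
  have hi2 : Integrable fun x => ‖D j x - g j n x‖ := ((L1.integrable_coeFn (D j)).sub (hg4 j n)).norm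
  have hi3 : Integrable fun x => ‖f x - g j n x‖ := (hf.sub (hg4 j n)).norm
  have h5 : ∫ x, ‖f x - g j n x‖ ≤ ∫ x, (‖f x - D j x‖ + ‖D j x - g j n x‖) :=
    integral_mono hi3 (hi1.add hi2) fun x => norm_sub_le_norm_sub_add_norm_sub _ _ _
  rw [integral_add hi1 hi2] at h5
  have := hg2 j n
  linarith

lemma AuxDens.int_mul {Λ M C : ℝ} {r φ : V → ℝ} (hr : AuxDens d Λ M r)
    (hφ : AEStronglyMeasurable φ) (hC : ∀ᵐ x, |φ x| ≤ C) : Integrable fun x => φ x * r x :=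
  hr.integrable.bdd_mul hφ hC

lemma AuxDens.Λ_nonneg {Λ M : ℝ} {r : V → ℝ} (hr : AuxDens d Λ M r) : 0 ≤ Λ :=
  (hr.nonneg 0).trans (hr.le 0)

lemma AuxDens.abs_le {Λ M C : ℝ} {r φ : V → ℝ} (hr : AuxDens d Λ M r)
    (hC : ∀ᵐ x, |φ x| ≤ C) : |∫ x, φ x * r x| ≤ C := by
  have h := norm_integral_le_of_norm_le (f := fun x => φ x * r x) (hr.integrable.const_mul C) (by
    filter_upwards [hC] with x hx
    rw [norm_mul, Real.norm_of_nonneg (hr.nonneg x)]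
    exact mul_le_mul_of_nonneg_right hx (hr.nonneg x))
  rwa [integral_const_mul, hr.mass, mul_one, Real.norm_eq_abs] at h

lemma AuxDens.approx {R Λ M C : ℝ} (hR : 0 < R) {r φ g : V → ℝ} (hr : AuxDens d Λ M r) (hC0 : 0 ≤ C)
    (hφ : AEStronglyMeasurable φ) (hC : ∀ᵐ x, |φ x| ≤ C) (hg : Continuous g)
    (hgc : HasCompactSupport g) :
    |(∫ x, φ x * r x) - ∫ x, g x * r x| ≤
      C / R * M + Λ * ∫ x, ‖(Metric.ball (0:V) R).indicator φ x - g x‖ := by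
  have hf : Integrable ((Metric.ball (0:V) R).indicator φ) := by
    rw [integrable_indicator_iff Metric.isOpen_ball.measurableSet]
    refine Measure.integrableOn_of_bounded (M := C) Metric.isBounded_ball.measure_lt_top.ne hφ ?_
    exact ae_restrict_of_ae hC
  have hgi : Integrable g := hg.integrable_of_hasCompactSupport hgc
  obtain ⟨Cg, hCg⟩ := hg.bounded_above_of_compact_support hgc
  have i1 := hr.int_mul hφ hC
  have i2 := hr.int_mul hg.aestronglyMeasurable (Eventually.of_forall hCg)
  rw [← integral_sub i1 i2]
  have i3 : Integrable fun x : V => C / R * (‖x‖ * r x) := hr.integrable_mom.const_mul _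
  have i4 : Integrable fun x : V => Λ * ‖(Metric.ball (0:V) R).indicator φ x - g x‖ :=
    (hf.sub hgi).norm.const_mul _
  have h := norm_integral_le_of_norm_le (f := fun x => φ x * r x - g x * r x) (i3.add i4) (by
    filter_upwards [hC] with x hx
    have h0 := hr.nonneg x
    have hl := hr.le x
    have hL := hr.Λ_nonneg
    rw [← sub_mul, norm_mul, Real.norm_of_nonneg h0, Pi.add_apply]
    by_cases hxB : x ∈ Metric.ball (0:V) R
    · rw [indicator_of_mem hxB, mul_comm]
      have h1 : r x * ‖φ x - g x‖ ≤ Λ * ‖φ x - g x‖ := mul_le_mul_of_nonneg_right hl (norm_nonneg _)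
      have : 0 ≤ C / R * (‖x‖ * r x) := by positivity
      linarith
    · rw [indicator_of_notMem hxB, zero_sub, norm_neg]
      have hxR : R ≤ ‖x‖ := by simpa using hxB
      have h1 : ‖φ x - g x‖ ≤ C + ‖g x‖ := (norm_sub_le _ _).trans (by
        rw [Real.norm_eq_abs (φ x)]; linarith)
      have h2 : C ≤ C / R * ‖x‖ := by
        rw [div_mul_eq_mul_div, le_div_iff₀ hR]; exact mul_le_mul_of_nonneg_left hxR hC0
      have h3 : ‖φ x - g x‖ * r x ≤ (C / R * ‖x‖ + ‖g x‖) * r x :=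
        mul_le_mul_of_nonneg_right (by linarith) h0
      have h4 : r x * ‖g x‖ ≤ Λ * ‖g x‖ := mul_le_mul_of_nonneg_right hl (norm_nonneg _)
      linarith)
  have h6 := integral_add i3 i4
  rw [integral_const_mul, integral_const_mul] at h6
  have h5 : C / R * ∫ x, ‖x‖ * r x ≤ C / R * M := mul_le_mul_of_nonneg_left hr.mom (by positivity)
  rw [Real.norm_eq_abs] at h
  refine h.trans ?_
  show ∫ x, (C / R * (‖x‖ * r x) + Λ * ‖(Metric.ball (0:V) R).indicator φ x - g x‖) ≤ _
  rw [h6]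
  linarith

lemma aux_approx {g : ℕ → V → ℝ} (hg : ∀ j, Continuous (g j) ∧ HasCompactSupport (g j))
    (hd : ∀ f : V → ℝ, Integrable f → ∀ ε > 0, ∃ j, ∫ x, ‖f x - g j x‖ ≤ ε)
    {φ : V → ℝ} {C : ℝ} (hφ : AEStronglyMeasurable φ) (hC : ∀ᵐ x, |φ x| ≤ C) (Λ M : ℝ) {ε : ℝ}
    (hε : 0 < ε) :
    ∃ j, ∀ r, AuxDens d Λ M r → |(∫ x, φ x * r x) - ∫ x, g j x * r x| ≤ ε := by
  have hC' : ∀ᵐ x, |φ x| ≤ |C| := hC.mono fun x hx => hx.trans (le_abs_self C)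
  set R := 2 * |C| * |M| / ε + 1 with hRd
  have hR : 0 < R := by positivity
  have hf : Integrable ((Metric.ball (0:V) R).indicator φ) := by
    rw [integrable_indicator_iff Metric.isOpen_ball.measurableSet]
    refine Measure.integrableOn_of_bounded (M := C) Metric.isBounded_ball.measure_lt_top.ne hφ ?_
    exact ae_restrict_of_ae hC
  obtain ⟨j, hj⟩ := hd _ hf (ε / (2 * (|Λ| + 1))) (by positivity)
  refine ⟨j, fun r hr => (hr.approx hR (abs_nonneg C) hφ hC' (hg j).1 (hg j).2).trans ?_⟩
  have h1 : |C| / R * M ≤ ε / 2 := by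
    have : |C| / R * M ≤ |C| / R * |M| := mul_le_mul_of_nonneg_left (le_abs_self M) (by positivity)
    refine this.trans ?_
    rw [div_mul_eq_mul_div, div_le_iff₀ hR, hRd]
    have : ε / 2 * (2 * |C| * |M| / ε + 1) = |C| * |M| + ε / 2 := by field_simp
    rw [this]; linarith
  have h2 : Λ * (∫ x, ‖(Metric.ball (0:V) R).indicator φ x - g j x‖) ≤ ε / 2 := by
    have hL := hr.Λ_nonneg
    have h3 := mul_le_mul_of_nonneg_left hj hL
    refine h3.trans ?_
    rw [abs_of_nonneg hL, mul_div_assoc', div_le_div_iff₀ (by positivity) (by positivity)]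
    nlinarith
  linarith

lemma auxS_integral {X : Type*} [MeasurableSpace X] {ν : Measure X} (a : ℕ →₀ ℝ) (f : ℕ → X → ℝ)
    (hf : ∀ N, Integrable (f N) ν) :
    Integrable (fun x => auxS a (fun N => f N x)) ν ∧
    ∫ x, auxS a (fun N => f N x) ∂ν = auxS a (fun N => ∫ x, f N x ∂ν) := by
  simp only [auxS_eq, smul_eq_mul]
  refine ⟨integrable_finsetSum _ fun N _ => (hf N).const_mul _, ?_⟩
  rw [integral_finsetSum _ fun N _ => (hf N).const_mul _]
  exact Finset.sum_congr rfl fun N _ => integral_const_mul _ _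

lemma auxS_mul (a : ℕ →₀ ℝ) (y : ℝ) (e : ℕ → ℝ) : y * auxS a e = auxS a (fun N => y * e N) := by
  simp only [auxS_eq, smul_eq_mul, Finset.mul_sum]
  exact Finset.sum_congr rfl fun N _ => by ring

lemma AuxW.bounds {c : ℕ → (ℕ →₀ ℝ)} (hc : AuxW c) (k : ℕ) {e : ℕ → ℝ} {A : ℝ}
    (h : ∀ N, e N ≤ A) : auxS (c k) e ≤ A := by
  rw [auxS_eq]
  calc ∑ N ∈ (c k).support, c k N • e N ≤ ∑ N ∈ (c k).support, c k N * A :=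
        Finset.sum_le_sum fun N _ => mul_le_mul_of_nonneg_left (h N) (hc.nonneg k N)
    _ = A := by rw [← Finset.sum_mul, hc.sum, one_mul]

lemma AuxDens.comb {Λ M : ℝ} {r : ℕ → V → ℝ} (hr : ∀ N, AuxDens d Λ M (r N))
    {c : ℕ → (ℕ →₀ ℝ)} (hc : AuxW c) (k : ℕ) :
    AuxDens d Λ M (fun x => auxS (c k) (fun N => r N x)) := by
  have h1 := auxS_integral (c k) r (fun N => (hr N).integrable)
  have h2 := auxS_integral (c k) (fun N x => ‖x‖ * r N x) (fun N => (hr N).integrable_mom)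
  refine ⟨?_, fun x => ?_, fun x => hc.bounds k fun N => (hr N).le x, h1.1, ?_, ?_, ?_⟩
  · simp only [auxS_eq, smul_eq_mul]
    exact Finset.measurable_fun_sum _ fun N _ => (hr N).meas.const_mul _
  · rw [auxS_eq]
    exact Finset.sum_nonneg fun N _ => mul_nonneg (hc.nonneg k N) ((hr N).nonneg x)
  · rw [h1.2]
    simp only [(hr _).mass]
    exact hc.mass k
  · simp only [auxS_mul]; exact h2.1
  · simp only [auxS_mul]
    rw [h2.2]
    exact hc.bounds k fun N => (hr N).mom

lemma aux_limit_ae {Λ M : ℝ} {r : ℕ → V → ℝ} (hr : ∀ N, AuxDens d Λ M (r N))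
    (hl : ∀ᵐ x, ∃ l, Tendsto (fun k => r k x) atTop (𝓝 l)) :
    ∃ ρ, AuxDens d Λ M ρ ∧ ∀ (φ : V → ℝ) (C : ℝ), AEStronglyMeasurable φ → (∀ᵐ x, |φ x| ≤ C) →
      Tendsto (fun k => ∫ x, φ x * r k x) atTop (𝓝 (∫ x, φ x * ρ x)) := by
  obtain ⟨f, hf, hlim⟩ := measurable_limit_of_tendsto_metrizable_ae
    (fun n => (hr n).meas.aemeasurable) hl
  have hL := (hr 0).Λ_nonneg
  set ρ : V → ℝ := fun x => max 0 (min Λ (f x)) with hρ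
  have hρm : Measurable ρ := by fun_prop
  have hρ0 : ∀ x, 0 ≤ ρ x := fun x => le_max_left _ _
  have hρL : ∀ x, ρ x ≤ Λ := fun x => max_le hL (min_le_left _ _)
  have hlim' : ∀ᵐ x, Tendsto (fun k => r k x) atTop (𝓝 (ρ x)) := by
    filter_upwards [hlim] with x hx
    have h1 : 0 ≤ f x := ge_of_tendsto' hx fun k => (hr k).nonneg x
    have h2 : f x ≤ Λ := le_of_tendsto' hx fun k => (hr k).le x
    simpa [hρ, h1, h2] using hx
  have hM0 : 0 ≤ M := le_trans (integral_nonneg fun x => mul_nonneg (norm_nonneg _) ((hr 0).nonneg x))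
    (hr 0).mom
  have fatou : ∀ (w : V → ℝ) (A : ℝ), Measurable w → (∀ x, 0 ≤ w x) → 0 ≤ A →
      (∀ k, Integrable (fun x => w x * r k x)) → (∀ k, ∫ x, w x * r k x ≤ A) →
      Integrable (fun x => w x * ρ x) ∧ ∫ x, w x * ρ x ≤ A := by
    intro w A hw hw0 hA hi hle
    have h1 : ∫⁻ x, ENNReal.ofReal (w x * ρ x) ≤ ENNReal.ofReal A := by
      calc ∫⁻ x, ENNReal.ofReal (w x * ρ x)
          = ∫⁻ x, liminf (fun k => ENNReal.ofReal (w x * r k x)) atTop := by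
            refine lintegral_congr_ae ?_
            filter_upwards [hlim'] with x hx
            exact ((ENNReal.continuous_ofReal.tendsto _).comp (hx.const_mul (w x))).liminf_eq.symm
        _ ≤ liminf (fun k => ∫⁻ x, ENNReal.ofReal (w x * r k x)) atTop :=
            lintegral_liminf_le fun k => (hw.mul (hr k).meas).ennreal_ofReal
        _ ≤ ENNReal.ofReal A := by
            refine liminf_le_of_le (by isBoundedDefault) fun b hb => ?_
            obtain ⟨k, hk⟩ := hb.exists
            refine hk.trans ?_
            rw [← ofReal_integral_eq_lintegral_ofReal (hi k)
              (Eventually.of_forall fun x => mul_nonneg (hw0 x) ((hr k).nonneg x))]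
            exact ENNReal.ofReal_le_ofReal (hle k)
    have h0 : 0 ≤ᵐ[volume] fun x => w x * ρ x :=
      Eventually.of_forall fun x => mul_nonneg (hw0 x) (hρ0 x)
    refine ⟨⟨(hw.mul hρm).aestronglyMeasurable, ?_⟩, ?_⟩
    · rw [hasFiniteIntegral_iff_ofReal h0]
      exact h1.trans_lt ENNReal.ofReal_lt_top
    · rw [integral_eq_lintegral_of_nonneg_ae h0 (hw.mul hρm).aestronglyMeasurable]
      exact ENNReal.toReal_le_of_le_ofReal hA h1
  obtain ⟨hmi, hmom⟩ := fatou (fun x => ‖x‖) M measurable_norm (fun x => norm_nonneg x) hM0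
    (fun k => (hr k).integrable_mom) (fun k => (hr k).mom)
  have hρi : Integrable ρ := by
    have := (fatou (fun _ => 1) 1 measurable_const (fun x => zero_le_one) zero_le_one
      (fun k => by simpa using (hr k).integrable) (fun k => by simp [(hr k).mass])).1
    simpa using this
  have hdi : ∀ k, Integrable fun x => |r k x - ρ x| := fun k => ((hr k).integrable.sub hρi).abs
  have hL1 : Tendsto (fun k => ∫ x, |r k x - ρ x|) atTop (𝓝 0) := by
    have hb : ∀ R : ℝ, 0 < R → ∀ k, ∫ x, |r k x - ρ x| ≤
        (∫ x in Metric.ball (0:V) R, |r k x - ρ x|) + 2 * M / R := by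
      intro R hR k
      rw [← integral_add_compl (Metric.isOpen_ball (x := (0:V)) (ε := R)).measurableSet (hdi k)]
      gcongr
      have hi2 : Integrable fun x : V => 1 / R * (‖x‖ * r k x + ‖x‖ * ρ x) :=
        ((hr k).integrable_mom.add hmi).const_mul _
      calc ∫ x in (Metric.ball (0:V) R)ᶜ, |r k x - ρ x|
          ≤ ∫ x in (Metric.ball (0:V) R)ᶜ, 1 / R * (‖x‖ * r k x + ‖x‖ * ρ x) := by
            refine setIntegral_mono_on (hdi k).integrableOn hi2.integrableOn
              Metric.isOpen_ball.measurableSet.compl fun x hx => ?_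
            have hxR : R ≤ ‖x‖ := by simpa using hx
            have h1 : |r k x - ρ x| ≤ r k x + ρ x := by
              rw [abs_le]; constructor <;> linarith [(hr k).nonneg x, hρ0 x]
            refine h1.trans ?_
            rw [← mul_add, ← mul_assoc, one_div_mul_eq_div]
            exact le_mul_of_one_le_left (add_nonneg ((hr k).nonneg x) (hρ0 x)) ((one_le_div hR).2 hxR)
        _ ≤ ∫ x, 1 / R * (‖x‖ * r k x + ‖x‖ * ρ x) := by
            refine setIntegral_le_integral hi2 (Eventually.of_forall fun x => ?_)
            have := (hr k).nonneg x; have := hρ0 x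
            show 0 ≤ 1 / R * (‖x‖ * r k x + ‖x‖ * ρ x)
            positivity
        _ ≤ 2 * M / R := by
            rw [integral_const_mul, integral_add (hr k).integrable_mom hmi, one_div_mul_eq_div]
            gcongr
            linarith [(hr k).mom]
    have hdct : ∀ R : ℝ, Tendsto (fun k => ∫ x in Metric.ball (0:V) R, |r k x - ρ x|) atTop (𝓝 0) := by
      intro R
      have : Tendsto (fun k => ∫ x in Metric.ball (0:V) R, |r k x - ρ x|) atTop
          (𝓝 (∫ x in Metric.ball (0:V) R, (0:ℝ))) := by
        refine tendsto_integral_of_dominated_convergence (fun _ => 2 * Λ)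
          (fun k => (hdi k).aestronglyMeasurable.restrict)
          (integrableOn_const Metric.isBounded_ball.measure_lt_top.ne)
          (fun k => Eventually.of_forall fun x => ?_) (ae_restrict_of_ae ?_)
        · rw [Real.norm_eq_abs, abs_abs, abs_le]
          constructor <;> linarith [(hr k).nonneg x, hρ0 x, (hr k).le x, hρL x]
        · filter_upwards [hlim'] with x hx
          have := (hx.sub_const (ρ x)).abs
          simpa using this
      simpa using this
    rw [Metric.tendsto_atTop]
    intro ε hε
    set R := 4 * M / ε + 1 with hR
    have hRp : 0 < R := by positivity
    obtain ⟨n, hn⟩ := (Metric.tendsto_atTop.1 (hdct R)) (ε / 2) (half_pos hε)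
    refine ⟨n, fun k hk => ?_⟩
    have h1 := hb R hRp k
    have h2 := hn k hk
    rw [Real.dist_eq, sub_zero] at h2 ⊢
    rw [abs_of_nonneg (integral_nonneg fun x => abs_nonneg _)]
    have h3 := lt_of_le_of_lt (le_abs_self _) h2
    have h4 : 2 * M / R ≤ ε / 2 := by
      rw [div_le_iff₀ hRp, hR]
      have : ε / 2 * (4 * M / ε + 1) = 2 * M + ε / 2 := by field_simp; ring
      rw [this]; linarith
    linarith
  have hconv : ∀ (φ : V → ℝ) (C : ℝ), AEStronglyMeasurable φ → (∀ᵐ x, |φ x| ≤ C) →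
      Tendsto (fun k => ∫ x, φ x * r k x) atTop (𝓝 (∫ x, φ x * ρ x)) := by
    intro φ C hφ hC
    rw [tendsto_iff_norm_sub_tendsto_zero]
    refine squeeze_zero (fun k => norm_nonneg _) (fun k => ?_)
      (by simpa using hL1.const_mul C : Tendsto (fun k => C * ∫ x, |r k x - ρ x|) atTop (𝓝 0))
    rw [← integral_sub ((hr k).int_mul hφ hC) (hρi.bdd_mul hφ hC), ← integral_const_mul]
    refine norm_integral_le_of_norm_le ((hdi k).const_mul C) ?_
    filter_upwards [hC] with x hx
    rw [← mul_sub, norm_mul]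
    exact mul_le_mul_of_nonneg_right hx (abs_nonneg _)
  refine ⟨ρ, ⟨hρm, hρ0, hρL, hρi, ?_, hmi, hmom⟩, hconv⟩
  have h1 := hconv (fun _ => 1) 1 aestronglyMeasurable_const (by simp)
  simp only [one_mul, (hr _).mass] at h1
  exact (tendsto_nhds_unique h1 tendsto_const_nhds)

lemma aux_limit {Λ M : ℝ} {g : ℕ → V → ℝ} (hg : ∀ j, Continuous (g j) ∧ HasCompactSupport (g j))
    (hd : ∀ f : V → ℝ, Integrable f → ∀ ε > 0, ∃ j, ∫ x, ‖f x - g j x‖ ≤ ε)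
    {r : ℕ → V → ℝ} (hr : ∀ N, AuxDens d Λ M (r N))
    (hl : ∀ j, ∃ l, Tendsto (fun k => ∫ x, g j x * r k x) atTop (𝓝 l)) :
    ∃ ρ, AuxDens d Λ M ρ ∧ ∀ (φ : V → ℝ) (C : ℝ), AEStronglyMeasurable φ → (∀ᵐ x, |φ x| ≤ C) →
      Tendsto (fun k => ∫ x, φ x * r k x) atTop (𝓝 (∫ x, φ x * ρ x)) := by
  obtain ⟨c, hc, hae⟩ := aux_komlos (volume : Measure V).toFinite (fun N _ x => r N x) (fun _ => Λ)
    (fun N _ => (hr N).meas) (fun N _ x => by rw [abs_of_nonneg ((hr N).nonneg x)]; exact (hr N).le x)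
  rw [ae_toFinite] at hae
  obtain ⟨ρ, hρ, hconv⟩ := aux_limit_ae (fun k => AuxDens.comb hr hc k) (hae.mono fun x hx => hx 0)
  refine ⟨ρ, hρ, fun φ C hφ hC => ?_⟩
  have hcau : CauchySeq fun k => ∫ x, φ x * r k x := by
    rw [Metric.cauchySeq_iff']
    intro ε hε
    obtain ⟨j, hj⟩ := aux_approx hg hd hφ hC Λ M (ε := ε / 4) (by positivity)
    obtain ⟨l, hl⟩ := hl j
    obtain ⟨n, hn⟩ := Metric.cauchySeq_iff'.1 hl.cauchySeq (ε / 4) (by positivity)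
    refine ⟨n, fun k hk => ?_⟩
    have h1 := hj _ (hr k)
    have h2 := hj _ (hr n)
    have h3 := hn k hk
    rw [Real.dist_eq] at h3 ⊢
    rw [abs_le] at h1 h2
    rw [abs_lt] at h3 ⊢
    constructor <;> linarith [h1.1, h1.2, h2.1, h2.2, h3.1, h3.2]
  obtain ⟨l, hl⟩ := cauchySeq_tendsto_of_complete hcau
  have h1 := hc.tendsto hl
  have h2 : ∀ k, auxS (c k) (fun N => ∫ x, φ x * r N x) = ∫ x, φ x * auxS (c k) (fun N => r N x) := by
    intro k
    rw [← (auxS_integral (c k) (fun N x => φ x * r N x) fun N => (hr N).int_mul hφ hC).2]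
    simp only [auxS_mul]
  rw [tendsto_nhds_unique (hconv φ C hφ hC) (h1.congr h2)]
  exact hl

structure AuxScheme (d : ℕ) (T K Λ M : ℝ) (ρ0 : EuclideanSpace ℝ (Fin d) → ℝ) (h : ℕ → ℝ)
    (β : ℕ → ℕ → EuclideanSpace ℝ (Fin d) → EuclideanSpace ℝ (Fin d))
    (r : ℕ → ℝ → EuclideanSpace ℝ (Fin d) → ℝ) : Prop where
  hpos : ∀ N, 0 < h N
  hlim : Tendsto h atTop (𝓝 0)
  K0 : 0 ≤ K
  bd : ∀ N k x, ‖β N k x‖ ≤ K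
  cont : ∀ N k, Continuous (β N k)
  dens0 : AuxDens d Λ M ρ0
  dens : ∀ N, ∀ t ∈ Icc (0:ℝ) T, AuxDens d Λ M (r N t)
  push : ∀ N, ∀ t ∈ Icc (0:ℝ) T, ∀ φ : EuclideanSpace ℝ (Fin d) → ℝ, Measurable φ →
    ∫ x, φ (auxY (h N) (β N) ⌊t / h N⌋₊ x) * ρ0 x = ∫ x, φ x * r N t x

lemma auxScheme_exists {T K c R m : ℝ} {ρ0 : V → ℝ} {h : ℕ → ℝ} {β : ℕ → ℕ → V → V}
    (h0 : AuxDens d R m ρ0) (hc : 0 ≤ c) (hT : 0 < T)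
    (hpos : ∀ N, 0 < h N) (hlim : Tendsto h atTop (𝓝 0)) (K0 : 0 ≤ K)
    (bd : ∀ N k x, ‖β N k x‖ ≤ K) (cont : ∀ N k, Continuous (β N k))
    (hp : ∀ N k (f : V → ℝ≥0∞), ∫⁻ x, f (x - h N • β N k x) ≤ ENNReal.ofReal (1 + c * h N) * ∫⁻ x, f x) :
    ∃ r, AuxScheme d T K (R * Real.exp (c * T)) (m + K * T) ρ0 h β r := by
  have key : ∀ N t, ∃ r, t ∈ Icc (0:ℝ) T → AuxDens d (R * Real.exp (c * T)) (m + K * T) r ∧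
      ∀ φ : V → ℝ, Measurable φ →
        ∫ x, φ (auxY (h N) (β N) ⌊t / h N⌋₊ x) * ρ0 x = ∫ x, φ x * r x := by
    intro N t
    by_cases ht : t ∈ Icc (0:ℝ) T
    swap
    · exact ⟨0, fun h => absurd h ht⟩
    have hk : (⌊t / h N⌋₊ : ℝ) * h N ≤ t := by
      have := Nat.floor_le (div_nonneg ht.1 (hpos N).le)
      exact (le_div_iff₀ (hpos N)).1 this
    set k := ⌊t / h N⌋₊ with hkd
    have hpush := auxY_push (h := h N) (β := β N) (Λ := ENNReal.ofReal (1 + c * h N)) (hp N) k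
    obtain ⟨r, hr, hre⟩ := auxDens_push h0 (Λ := Real.exp (c * T)) (B := K * T)
      (Real.exp_pos _).le (auxY_cont (h := h N) (cont N) k).measurable (fun f => by
        refine (hpush f).trans (mul_le_mul_left ?_ _)
        have hn : 0 ≤ c * h N := mul_nonneg hc (hpos N).le
        rw [← ENNReal.ofReal_pow (by linarith)]
        refine ENNReal.ofReal_le_ofReal ?_
        calc (1 + c * h N) ^ k ≤ (Real.exp (c * h N)) ^ k := by
              refine pow_le_pow_left₀ (by linarith) ?_ k
              linarith [Real.add_one_le_exp (c * h N)]
          _ = Real.exp (c * (k * h N)) := by rw [← Real.exp_nat_mul]; congr 1; ring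
          _ ≤ Real.exp (c * T) := Real.exp_le_exp.2 (mul_le_mul_of_nonneg_left (hk.trans ht.2) hc))
      (fun x => by
        have h1 := auxY_step (hpos N).le (bd N) 0 k x
        rw [zero_add] at h1
        have h2 : auxY (h N) (β N) 0 x = x := rfl
        rw [h2] at h1
        have h3 : K * (h N * k) ≤ K * T := mul_le_mul_of_nonneg_left (by rw [mul_comm]; exact hk.trans ht.2) K0
        have h4 := norm_le_norm_add_norm_sub' (auxY (h N) (β N) k x) x
        linarith)
    exact ⟨r, fun _ => ⟨hr, hre⟩⟩
  choose r hr using key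
  have hR : 0 ≤ R := h0.Λ_nonneg
  refine ⟨r, hpos, hlim, K0, bd, cont, ⟨h0.meas, h0.nonneg, fun x => (h0.le x).trans ?_, h0.integrable, h0.mass,
    h0.integrable_mom, h0.mom.trans ?_⟩, fun N t ht => (hr N t ht).1, fun N t ht => (hr N t ht).2⟩
  · exact le_mul_of_one_le_right hR (Real.one_le_exp (by positivity))
  · have : 0 ≤ K * T := by positivity
    linarith

section
variable {T K Λ M : ℝ} {ρ0 : EuclideanSpace ℝ (Fin d) → ℝ} {h : ℕ → ℝ} {β : ℕ → ℕ → EuclideanSpace ℝ (Fin d) → EuclideanSpace ℝ (Fin d)} {r : ℕ → ℝ → EuclideanSpace ℝ (Fin d) → ℝ}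
  {c : ℕ → (ℕ →₀ ℝ)}

lemma AuxScheme.modulus (hs : AuxScheme d T K Λ M ρ0 h β r) {φ : V → ℝ} (hφ : Continuous φ)
    (hφc : HasCompactSupport φ) {ε : ℝ} (hε : 0 < ε) :
    ∃ δ > 0, ∀ N, ∀ s ∈ Icc (0:ℝ) T, ∀ t ∈ Icc (0:ℝ) T, K * (|t - s| + h N) < δ →
      |(∫ x, φ x * r N t x) - ∫ x, φ x * r N s x| ≤ ε := by
  obtain ⟨δ, hδ, hu⟩ := Metric.uniformContinuous_iff.1 (hφc.uniformContinuous_of_continuous hφ) ε hε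
  have key : ∀ N, ∀ s ∈ Icc (0:ℝ) T, ∀ t ∈ Icc (0:ℝ) T, s ≤ t → K * (|t - s| + h N) < δ →
      |(∫ x, φ x * r N t x) - ∫ x, φ x * r N s x| ≤ ε := by
    intro N s hsm t htm hst hlt
    rw [abs_of_nonneg (sub_nonneg.2 hst)] at hlt
    have hp := hs.hpos N
    rw [← hs.push N t htm φ hφ.measurable, ← hs.push N s hsm φ hφ.measurable]
    obtain ⟨n, hn⟩ := Nat.exists_eq_add_of_le
      (Nat.floor_mono (div_le_div_of_nonneg_right hst hp.le) : ⌊s / h N⌋₊ ≤ ⌊t / h N⌋₊)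
    have hnh : h N * n ≤ t - s + h N := by
      have h1 := Nat.floor_le (div_nonneg htm.1 hp.le)
      have h2 := Nat.lt_floor_add_one (s / h N)
      rw [le_div_iff₀ hp] at h1
      rw [div_lt_iff₀ hp] at h2
      rw [hn] at h1
      push_cast at h1
      nlinarith
    obtain ⟨C, hC⟩ := hφ.bounded_above_of_compact_support hφc
    have hint : ∀ k, Integrable fun x => φ (auxY (h N) (β N) k x) * ρ0 x := fun k =>
      hs.dens0.int_mul (hφ.comp (auxY_cont (hs.cont N) k)).aestronglyMeasurable
        (Eventually.of_forall fun x => hC _)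
    rw [← integral_sub (hint _) (hint _)]
    simp only [← sub_mul]
    refine hs.dens0.abs_le (Eventually.of_forall fun x => ?_)
    rw [← Real.dist_eq]
    refine (hu ?_).le
    rw [dist_eq_norm, hn]
    refine (auxY_step hp.le (hs.bd N) _ _ x).trans_lt (lt_of_le_of_lt ?_ hlt)
    exact mul_le_mul_of_nonneg_left hnh hs.K0
  refine ⟨δ, hδ, fun N s hsm t htm hlt => ?_⟩
  rcases le_total s t with hst | hst
  · exact key N s hsm t htm hst hlt
  · rw [abs_sub_comm]
    rw [abs_sub_comm] at hlt
    exact key N t htm s hsm hst hlt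

lemma auxS_sub (a : ℕ →₀ ℝ) (e e' : ℕ → ℝ) : auxS a e - auxS a e' = auxS a (fun N => e N - e' N) := by
  simp only [auxS_eq, smul_eq_mul, mul_sub, Finset.sum_sub_distrib]

lemma AuxScheme.modulusS (hs : AuxScheme d T K Λ M ρ0 h β r) (hc : AuxW c) {φ : V → ℝ} (hφ : Continuous φ)
    (hφc : HasCompactSupport φ) {ε : ℝ} (hε : 0 < ε) :
    ∃ δ > 0, ∃ n : ℕ, ∀ s ∈ Icc (0:ℝ) T, ∀ t ∈ Icc (0:ℝ) T, |t - s| < δ → ∀ k ≥ n,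
      |auxS (c k) (fun N => ∫ x, φ x * r N t x) - auxS (c k) (fun N => ∫ x, φ x * r N s x)| ≤ ε := by
  obtain ⟨δ, hδ, hm⟩ := hs.modulus hφ hφc hε
  have hK := hs.K0
  have hlim := Metric.tendsto_atTop.1 hs.hlim (δ / (2 * (K + 1))) (by positivity)
  obtain ⟨n, hn⟩ := hlim
  refine ⟨δ / (2 * (K + 1)), by positivity, n, fun s hsm t htm hlt k hk => ?_⟩
  rw [auxS_sub, ← Real.norm_eq_abs]
  refine hc.norm_le k fun N hN => hm N s hsm t htm ?_
  have h1 := hn N (hk.trans hN)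
  rw [Real.dist_eq, sub_zero] at h1
  have h2 := (le_abs_self _).trans_lt h1
  have h3 : 0 ≤ |t - s| := abs_nonneg _
  have h4 : δ / (2 * (K + 1)) * (2 * (K + 1)) = δ := by field_simp
  have h5 := hs.hpos N
  nlinarith

lemma AuxScheme.allt (hs : AuxScheme d T K Λ M ρ0 h β r) (hc : AuxW c) {φ : V → ℝ} (hφ : Continuous φ)
    (hφc : HasCompactSupport φ) {q : ℕ → Icc (0:ℝ) T} (hq : DenseRange q)
    (hl : ∀ i, ∃ l, Tendsto (fun k => auxS (c k) (fun N => ∫ x, φ x * r N (q i) x)) atTop (𝓝 l))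
    {t : ℝ} (ht : t ∈ Icc (0:ℝ) T) :
    ∃ l, Tendsto (fun k => auxS (c k) (fun N => ∫ x, φ x * r N t x)) atTop (𝓝 l) := by
  refine cauchySeq_tendsto_of_complete ?_
  rw [Metric.cauchySeq_iff']
  intro ε hε
  obtain ⟨δ, hδ, n, hm⟩ := hs.modulusS hc hφ hφc (ε := ε / 4) (by positivity)
  obtain ⟨i, hi⟩ := hq.exists_dist_lt ⟨t, ht⟩ hδ
  obtain ⟨l, hl⟩ := hl i
  obtain ⟨n', hn'⟩ := Metric.cauchySeq_iff.1 hl.cauchySeq (ε / 4) (by positivity)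
  have hi' : |t - q i| < δ := by
    rw [Subtype.dist_eq, Real.dist_eq] at hi; exact hi
  refine ⟨max n n', fun k hk => ?_⟩
  have h1 := hm (q i) (q i).2 t ht hi' k (le_trans (le_max_left _ _) hk)
  have h2 := hm (q i) (q i).2 t ht hi' (max n n') (le_max_left _ _)
  have h3 := hn' k (le_trans (le_max_right _ _) hk) (max n n') (le_max_right _ _)
  rw [Real.dist_eq] at h3 ⊢
  rw [abs_le] at h1 h2
  rw [abs_lt] at h3 ⊢
  constructor <;> linarith [h1.1, h1.2, h2.1, h2.2, h3.1, h3.2]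

lemma AuxScheme.limit (hs : AuxScheme d T K Λ M ρ0 h β r) (hc : AuxW c) {g : ℕ → V → ℝ}
    (hg : ∀ j, Continuous (g j) ∧ HasCompactSupport (g j))
    (hd : ∀ f : V → ℝ, Integrable f → ∀ ε > 0, ∃ j, ∫ x, ‖f x - g j x‖ ≤ ε) {t : ℝ} (ht : t ∈ Icc (0:ℝ) T)
    (hl : ∀ j, ∃ l, Tendsto (fun k => auxS (c k) (fun N => ∫ x, g j x * r N t x)) atTop (𝓝 l)) :
    ∃ ρ, AuxDens d Λ M ρ ∧ ∀ (φ : V → ℝ) (C : ℝ), AEStronglyMeasurable φ → (∀ᵐ x, |φ x| ≤ C) →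
      Tendsto (fun k => auxS (c k) (fun N => ∫ x, φ x * r N t x)) atTop (𝓝 (∫ x, φ x * ρ x)) := by
  have h2 : ∀ (φ : V → ℝ) (C : ℝ), AEStronglyMeasurable φ → (∀ᵐ x, |φ x| ≤ C) → ∀ k,
      auxS (c k) (fun N => ∫ x, φ x * r N t x) = ∫ x, φ x * auxS (c k) (fun N => r N t x) := by
    intro φ C hφ hC k
    rw [← (auxS_integral (c k) (fun N x => φ x * r N t x) fun N => (hs.dens N t ht).int_mul hφ hC).2]
    simp only [auxS_mul]
  obtain ⟨ρ, hρ, hconv⟩ := aux_limit (Λ := Λ) (M := M) hg hd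
    (fun k => AuxDens.comb (fun N => hs.dens N t ht) hc k) (fun j => by
      obtain ⟨C, hC⟩ := (hg j).1.bounded_above_of_compact_support (hg j).2
      obtain ⟨l, hl⟩ := hl j
      exact ⟨l, hl.congr (h2 (g j) C (hg j).1.aestronglyMeasurable (Eventually.of_forall hC))⟩)
  refine ⟨ρ, hρ, fun φ C hφ hC => (hconv φ C hφ hC).congr fun k => (h2 φ C hφ hC k).symm⟩

lemma AuxScheme.timeCont (hs : AuxScheme d T K Λ M ρ0 h β r) (hc : AuxW c) {g : ℕ → V → ℝ}
    (hg : ∀ j, Continuous (g j) ∧ HasCompactSupport (g j))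
    (hd : ∀ f : V → ℝ, Integrable f → ∀ ε > 0, ∃ j, ∫ x, ‖f x - g j x‖ ≤ ε)
    {ρ : ℝ → V → ℝ} (hρ : ∀ t ∈ Icc (0:ℝ) T, AuxDens d Λ M (ρ t))
    (hl : ∀ t ∈ Icc (0:ℝ) T, ∀ (φ : V → ℝ) (C : ℝ), AEStronglyMeasurable φ → (∀ᵐ x, |φ x| ≤ C) →
      Tendsto (fun k => auxS (c k) (fun N => ∫ x, φ x * r N t x)) atTop (𝓝 (∫ x, φ x * ρ t x)))
    {φ : V → ℝ} {C : ℝ} (hφ : Continuous φ) (hC : ∀ x, |φ x| ≤ C) :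
    ContinuousOn (fun t => ∫ x, φ x * ρ t x) (Icc (0:ℝ) T) := by
  rw [Metric.continuousOn_iff]
  intro t ht ε hε
  obtain ⟨j, hj⟩ := aux_approx hg hd hφ.aestronglyMeasurable (Eventually.of_forall hC) Λ M (ε := ε / 4) (by positivity)
  obtain ⟨δ, hδ, n, hm⟩ := hs.modulusS hc (hg j).1 (hg j).2 (ε := ε / 4) (by positivity)
  obtain ⟨C', hC'⟩ := (hg j).1.bounded_above_of_compact_support (hg j).2
  refine ⟨δ, hδ, fun s hsm hst => ?_⟩
  have hT : ∀ t ∈ Icc (0:ℝ) T, Tendsto (fun k => auxS (c k) (fun N => ∫ x, g j x * r N t x)) atTop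
    (𝓝 (∫ x, g j x * ρ t x)) := fun t ht =>
      hl t ht (g j) C' (hg j).1.aestronglyMeasurable (Eventually.of_forall hC')
  have h3 : |(∫ x, g j x * ρ s x) - ∫ x, g j x * ρ t x| ≤ ε / 4 := by
    refine le_of_tendsto ((hT s hsm).sub (hT t ht)).abs ?_
    filter_upwards [eventually_ge_atTop n] with k hk
    exact hm t ht s hsm hst k hk
  have h1 := hj _ (hρ t ht)
  have h2 := hj _ (hρ s hsm)
  rw [Real.dist_eq, abs_lt]
  rw [abs_le] at h1 h2 h3
  constructor <;> linarith [h1.1, h1.2, h2.1, h2.2, h3.1, h3.2]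
end

lemma aux_grad_cont {φ : V → ℝ} (hφ : ContDiff ℝ (⊤ : ℕ∞) φ) : Continuous (gradient φ) := by
  have h1 : Continuous (fderiv ℝ φ) := (contDiff_infty.1 hφ 2).continuous_fderiv (by norm_num)
  exact (InnerProductSpace.toDual ℝ V).symm.continuous.comp h1

lemma AuxScheme.weak_pt {T K Λ M : ℝ} {ρ0 : V → ℝ} {h : ℕ → ℝ} {β : ℕ → ℕ → V → V} {r : ℕ → ℝ → V → ℝ}
    {c : ℕ → (ℕ →₀ ℝ)} (hs : AuxScheme d T K Λ M ρ0 h β r) (hc : AuxW c) {s : ℝ} (hsm : s ∈ Icc (0:ℝ) T)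
    {b : V → V} (hb : ∀ᵐ x, Tendsto (fun N => β N ⌊s / h N⌋₊ x) atTop (𝓝 (b x)))
    {ρ : V → ℝ}
    (hl : ∀ (φ : V → ℝ) (C : ℝ), AEStronglyMeasurable φ → (∀ᵐ x, |φ x| ≤ C) →
      Tendsto (fun k => auxS (c k) (fun N => ∫ x, φ x * r N s x)) atTop (𝓝 (∫ x, φ x * ρ x)))
    {φ : V → ℝ} (hφ : ContDiff ℝ (⊤ : ℕ∞) φ) (hφc : HasCompactSupport φ) :
    Tendsto (fun k => auxS (c k) (fun N => ∫ x, ⟪gradient φ (auxY (h N) (β N) ⌊s / h N⌋₊ x),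
      β N ⌊s / h N⌋₊ (auxY (h N) (β N) ⌊s / h N⌋₊ x)⟫ * ρ0 x)) atTop
      (𝓝 (∫ x, ⟪gradient φ x, b x⟫ * ρ x)) := by
  have hgc := aux_grad_cont hφ
  have hgi : Integrable fun x => ‖gradient φ x‖ := by
    refine hgc.norm.integrable_of_hasCompactSupport ?_
    have : HasCompactSupport fun x => ‖fderiv ℝ φ x‖ := (hφc.fderiv ℝ).norm
    simpa only [aux_norm_grad] using this
  have hgb : ∃ C, ∀ x, ‖gradient φ x‖ ≤ C := by
    refine hgc.bounded_above_of_compact_support ?_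
    have : HasCompactSupport fun x => ‖fderiv ℝ φ x‖ := (hφc.fderiv ℝ).norm
    rw [← hasCompactSupport_norm_iff]
    simpa only [aux_norm_grad] using this
  obtain ⟨C, hC⟩ := hgb
  have hC0 : 0 ≤ C := (norm_nonneg _).trans (hC 0)
  have hbm : AEStronglyMeasurable b :=
    aestronglyMeasurable_of_tendsto_ae atTop (fun N => (hs.cont N ⌊s / h N⌋₊).aestronglyMeasurable) hb
  have hbK : ∀ᵐ x, ‖b x‖ ≤ K := by
    filter_upwards [hb] with x hx
    exact le_of_tendsto' hx.norm fun N => hs.bd _ _ _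
  set ψ : V → ℝ := fun x => ⟪gradient φ x, b x⟫ with hψ
  have hψm : AEStronglyMeasurable ψ := hgc.aestronglyMeasurable.inner hbm
  have hψb : ∀ᵐ x, |ψ x| ≤ C * K := by
    filter_upwards [hbK] with x hx
    exact (abs_real_inner_le_norm _ _).trans (mul_le_mul (hC x) hx (norm_nonneg _) hC0)
  set ψN : ℕ → V → ℝ := fun N x => ⟪gradient φ x, β N ⌊s / h N⌋₊ x⟫ with hψN
  have hψNc : ∀ N, Continuous (ψN N) := fun N => hgc.inner (hs.cont N _)
  have hψNb : ∀ N x, |ψN N x| ≤ C * K := fun N x =>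
    (abs_real_inner_le_norm _ _).trans (mul_le_mul (hC x) (hs.bd _ _ _) (norm_nonneg _) hC0)
  have hpush : ∀ N, ∫ x, ⟪gradient φ (auxY (h N) (β N) ⌊s / h N⌋₊ x),
      β N ⌊s / h N⌋₊ (auxY (h N) (β N) ⌊s / h N⌋₊ x)⟫ * ρ0 x = ∫ x, ψN N x * r N s x := fun N =>
    hs.push N s hsm (ψN N) (hψNc N).measurable
  simp only [hpush]
  have hdi : ∀ N, Integrable fun x => |ψN N x - ψ x| := by
    intro N
    refine Integrable.mono' (hgi.mul_const (2 * K))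
      (((hψNc N).aestronglyMeasurable.sub hψm).norm) ?_
    filter_upwards [hbK] with x hx
    rw [norm_abs_eq_norm, hψN, hψ]
    simp only
    rw [← inner_sub_right]
    refine (norm_inner_le_norm _ _).trans (mul_le_mul_of_nonneg_left ?_ (norm_nonneg _))
    have := norm_sub_le (β N ⌊s / h N⌋₊ x) (b x)
    linarith [hs.bd N ⌊s / h N⌋₊ x]
  have hd0 : Tendsto (fun N => ∫ x, |ψN N x - ψ x|) atTop (𝓝 0) := by
    have : Tendsto (fun N => ∫ x, |ψN N x - ψ x|) atTop (𝓝 (∫ _ : V, (0:ℝ))) := by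
      refine tendsto_integral_of_dominated_convergence (fun x => ‖gradient φ x‖ * (2 * K))
        (fun N => (hdi N).aestronglyMeasurable) (hgi.mul_const (2 * K)) (fun N => ?_) ?_
      · filter_upwards [hbK] with x hx
        rw [norm_abs_eq_norm, hψN, hψ]
        simp only
        rw [← inner_sub_right]
        refine (norm_inner_le_norm _ _).trans (mul_le_mul_of_nonneg_left ?_ (norm_nonneg _))
        have := norm_sub_le (β N ⌊s / h N⌋₊ x) (b x)
        linarith [hs.bd N ⌊s / h N⌋₊ x]
      · filter_upwards [hb] with x hx
        have h1 : Tendsto (fun N => ψN N x) atTop (𝓝 (ψ x)) := tendsto_const_nhds.inner hx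
        have h2 := (h1.sub_const (ψ x)).abs
        simpa using h2
    simpa using this
  have hdiff : Tendsto (fun N => (∫ x, ψN N x * r N s x) - ∫ x, ψ x * r N s x) atTop (𝓝 0) := by
    rw [tendsto_zero_iff_norm_tendsto_zero]
    refine squeeze_zero (fun k => norm_nonneg _) (fun N => ?_)
      (by simpa using hd0.const_mul Λ : Tendsto (fun N => Λ * ∫ x, |ψN N x - ψ x|) atTop (𝓝 0))
    have hr := hs.dens N s hsm
    rw [← integral_sub (hr.int_mul (hψNc N).aestronglyMeasurable (Eventually.of_forall (hψNb N)))
      (hr.int_mul hψm hψb), ← integral_const_mul]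
    refine norm_integral_le_of_norm_le ((hdi N).const_mul Λ) (Eventually.of_forall fun x => ?_)
    rw [← sub_mul, norm_mul, mul_comm, Real.norm_of_nonneg (hr.nonneg x)]
    exact mul_le_mul_of_nonneg_right (hr.le x) (abs_nonneg _)
  have h1 := (hc.tendsto hdiff).add (hl ψ _ hψm hψb)
  rw [zero_add] at h1
  refine h1.congr fun k => ?_
  rw [← auxS_sub]
  ring

lemma AuxScheme.weak {T K Λ M : ℝ} {ρ0 : V → ℝ} {h : ℕ → ℝ} {β : ℕ → ℕ → V → V} {r : ℕ → ℝ → V → ℝ}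
    {c : ℕ → (ℕ →₀ ℝ)} (hs : AuxScheme d T K Λ M ρ0 h β r) (hc : AuxW c)
    {b : ℝ → V → V} (hb : ∀ s ∈ Icc (0:ℝ) T, ∀ᵐ x, Tendsto (fun N => β N ⌊s / h N⌋₊ x) atTop (𝓝 (b s x)))
    {ρ : ℝ → V → ℝ}
    (hl : ∀ t ∈ Icc (0:ℝ) T, ∀ (φ : V → ℝ) (C : ℝ), AEStronglyMeasurable φ → (∀ᵐ x, |φ x| ≤ C) →
      Tendsto (fun k => auxS (c k) (fun N => ∫ x, φ x * r N t x)) atTop (𝓝 (∫ x, φ x * ρ t x)))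
    {φ : V → ℝ} (hφ : ContDiff ℝ (⊤ : ℕ∞) φ) (hφc : HasCompactSupport φ) {t : ℝ} (ht : t ∈ Icc (0:ℝ) T) :
    (∫ x, φ x * ρ t x) = (∫ x, φ x * ρ0 x) - ∫ s in Ioc (0:ℝ) t, ∫ x, ⟪gradient φ x, b s x⟫ * ρ s x := by
  obtain ⟨E, B, hEB⟩ := aux_euler (K := K) hφ hφc hs.dens0
  set γ : ℕ → ℕ → ℝ := fun N j => ∫ x, ⟪gradient φ (auxY (h N) (β N) j x),
      β N j (auxY (h N) (β N) j x)⟫ * ρ0 x with hγ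
  have hγb : ∀ N j, |γ N j| ≤ B := fun N => (hEB (h N) (β N) (hs.hpos N) (hs.bd N) (hs.cont N)).1
  have hγm : ∀ N, Measurable fun s : ℝ => γ N ⌊s / h N⌋₊ := fun N => aux_floor_meas (h N) (γ N)
  have hγi : ∀ N, Integrable (fun s : ℝ => γ N ⌊s / h N⌋₊) (volume.restrict (Ioc 0 t)) := fun N =>
    Measure.integrableOn_of_bounded (M := B) measure_Ioc_lt_top.ne (hγm N).aestronglyMeasurable
      (Eventually.of_forall fun s => hγb N _)
  have herr : ∀ N, |(∫ x, φ x * r N t x) - (∫ x, φ x * ρ0 x) + ∫ s in Ioc 0 t, γ N ⌊s / h N⌋₊|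
      ≤ (E * t + B) * h N := by
    intro N
    have := (hEB (h N) (β N) (hs.hpos N) (hs.bd N) (hs.cont N)).2 t ht.1
    rwa [hs.push N t ht φ hφ.continuous.measurable] at this
  have h0 : Tendsto (fun N => (∫ x, φ x * r N t x) - (∫ x, φ x * ρ0 x) + ∫ s in Ioc 0 t, γ N ⌊s / h N⌋₊)
      atTop (𝓝 0) := by
    rw [tendsto_zero_iff_norm_tendsto_zero]
    refine squeeze_zero (fun k => norm_nonneg _) herr ?_
    simpa using hs.hlim.const_mul (E * t + B)
  have h1 := hc.tendsto h0
  obtain ⟨C, hC⟩ := hφ.continuous.bounded_above_of_compact_support hφc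
  have h2 := hl t ht φ C hφ.continuous.aestronglyMeasurable (Eventually.of_forall hC)
  have h3 : Tendsto (fun k => ∫ s in Ioc 0 t, auxS (c k) (fun N => γ N ⌊s / h N⌋₊)) atTop
      (𝓝 (∫ s in Ioc (0:ℝ) t, ∫ x, ⟪gradient φ x, b s x⟫ * ρ s x)) := by
    refine tendsto_integral_of_dominated_convergence (fun _ => B)
      (fun k => (auxS_integral (c k) (fun N s => γ N ⌊s / h N⌋₊) hγi).1.aestronglyMeasurable)
      (integrableOn_const measure_Ioc_lt_top.ne)
      (fun k => Eventually.of_forall fun s => hc.norm_le k fun N _ => hγb N _) ?_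
    refine (ae_restrict_iff' measurableSet_Ioc).2 (Eventually.of_forall fun s hsm => ?_)
    have hsT : s ∈ Icc (0:ℝ) T := ⟨hsm.1.le, hsm.2.trans ht.2⟩
    exact hs.weak_pt hc hsT (hb s hsT) (hl s hsT) hφ hφc
  have h4 : ∀ k, auxS (c k) (fun N => (∫ x, φ x * r N t x) - (∫ x, φ x * ρ0 x) + ∫ s in Ioc 0 t, γ N ⌊s / h N⌋₊)
      = auxS (c k) (fun N => ∫ x, φ x * r N t x) - (∫ x, φ x * ρ0 x)
        + ∫ s in Ioc 0 t, auxS (c k) (fun N => γ N ⌊s / h N⌋₊) := by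
    intro k
    rw [(auxS_integral (c k) (fun N s => γ N ⌊s / h N⌋₊) hγi).2]
    simp only [auxS_eq, smul_eq_mul, mul_add, mul_sub, Finset.sum_add_distrib, Finset.sum_sub_distrib]
    rw [← Finset.sum_mul, hc.sum, one_mul]
  have h5 := (h2.sub_const (∫ x, φ x * ρ0 x)).add h3
  have h6 := tendsto_nhds_unique h5 (h1.congr h4)
  linarith

lemma aux_meas_int {α : Type*} [MeasurableSpace α] {h : ℝ} {β : ℕ → α → V → V} (k : ℕ)
    (hβ : ∀ j < k, Measurable fun q : α × V => β j q.1 q.2) {φ ρ0 : V → ℝ} (hφ : Measurable φ)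
    (hρ0 : Measurable ρ0) :
    Measurable fun a => ∫ x, φ (auxY h (fun j => β j a) k x) * ρ0 x := by
  have h1 : Measurable fun q : α × V => φ (auxY h (fun j => β j q.1) k q.2) * ρ0 q.2 :=
    (hφ.comp (auxY_meas k hβ)).mul (hρ0.comp measurable_snd)
  exact (h1.stronglyMeasurable.integral_prod_right (ν := (volume : Measure V))).measurable

lemma aux_meas_S {α : Type*} [MeasurableSpace α] (a : ℕ →₀ ℝ) {e : ℕ → α → ℝ} (he : ∀ N, Measurable (e N)) :
    Measurable fun ω => auxS a (fun N => e N ω) := by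
  simp only [auxS_eq, smul_eq_mul]
  exact Finset.measurable_fun_sum _ fun N _ => (he N).const_mul _

lemma aux_meas_lim {α : Type*} [MeasurableSpace α] {E : ℕ → ℕ → α → ℝ} (hE : ∀ j k, Measurable (E j k))
    {e : ℕ → α → ℝ} (he : ∀ k, Measurable (e k)) {f : α → ℝ} {z : ℝ}
    (h1 : ∀ a, (∀ j, ∃ l, Tendsto (fun k => E j k a) atTop (𝓝 l)) → Tendsto (fun k => e k a) atTop (𝓝 (f a)))
    (h2 : ∀ a, ¬ (∀ j, ∃ l, Tendsto (fun k => E j k a) atTop (𝓝 l)) → f a = z) : Measurable f := by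
  classical
  set A : Set α := {a | ∀ j, ∃ l, Tendsto (fun k => E j k a) atTop (𝓝 l)} with hA
  have hAm : MeasurableSet A := by
    have : A = ⋂ j, {a | ∃ l, Tendsto (fun k => E j k a) atTop (𝓝 l)} := by
      ext a; simp [hA]
    rw [this]
    exact MeasurableSet.iInter fun j => measurableSet_exists_tendsto (fun k => hE j k)
  refine measurable_of_tendsto_metrizable (f := fun k a => A.piecewise (e k) (fun _ => z) a)
    (fun k => (he k).piecewise hAm measurable_const) ?_
  rw [tendsto_pi_nhds]
  intro a
  by_cases ha : a ∈ A
  · simpa [ha] using h1 a ha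
  · simp only [Set.piecewise_eq_of_notMem _ _ _ ha]
    rw [h2 a ha]
    exact tendsto_const_nhds

lemma aux_dens0 {ρ0 : V → ℝ} {C : ℝ} (hρ0 : IsProbDensity d ρ0) (hC : ∀ x, ρ0 x ≤ C)
    (h2 : Integrable (fun x : V => ‖x‖ ^ 2 * ρ0 x)) : AuxDens d C (∫ x, ‖x‖ * ρ0 x) ρ0 := by
  have hi : Integrable ρ0 := integrable_of_integral_eq_one hρ0.2.2
  refine ⟨hρ0.1, hρ0.2.1, hC, hi, hρ0.2.2, ?_, le_rfl⟩
  refine Integrable.mono' (hi.add h2) (measurable_norm.mul hρ0.1).aestronglyMeasurable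
    (Eventually.of_forall fun x => ?_)
  have := hρ0.2.1 x
  rw [Real.norm_of_nonneg (by positivity), Pi.add_apply]
  nlinarith [sq_nonneg (‖x‖ - 1), mul_nonneg (sq_nonneg (‖x‖ - 1)) this, mul_nonneg (norm_nonneg x) this]

lemma aux_main {Ω : Type*} [mΩ : MeasurableSpace Ω] {T : ℝ} (hT : 0 < T) {μ : Measure Ω}
    [IsProbabilityMeasure μ]
    {F : Filtration ℝ mΩ} {H : ℝ → V → V → Ω → ℝ} {G : V → Ω → ℝ}
    (h1 : H1Hyp d μ F T H G) (h2 : H2Hyp d T H) {u M : ℝ → V → Ω → ℝ} (hu : HJReg d μ F T u M)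
    {ρ0 : V → ℝ} {R m : ℝ} (h0 : AuxDens d R m ρ0) :
    ∃ ρ : ℝ → V → Ω → ℝ, IsContEqSol d μ F T (fun s x ω => gradient (fun p : V => H s p x ω)
          (gradient (fun y : V => u s y ω) x)) ρ0 ρ := by
  obtain ⟨K, c0, h, β, hK, hc0, hpos, hlim, hmeas, hbd, hcont, hpush, hconv⟩ := aux_fields hT h1 h2 hu
  have hsch : ∀ ω, ∃ r, AuxScheme d T K (R * Real.exp (c0 * T)) (m + K * T) ρ0 h (fun N k => β N k ω) r :=
    fun ω => auxScheme_exists h0 hc0 hT hpos hlim hK (fun N k => hbd N k ω) (fun N k => hcont N k ω)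
      (fun N k => hpush N k ω)
  choose r hr using hsch
  set Λ := R * Real.exp (c0 * T) with hΛ
  set Mm := m + K * T with hMm
  obtain ⟨g, hg, hgd⟩ := aux_tests (d := d)
  have hem : ∀ N, ∀ t ∈ Icc (0:ℝ) T, ∀ φ : V → ℝ, Measurable φ →
      Measurable[F t] fun ω => ∫ x, φ x * r ω N t x := by
    intro N t ht φ hφ
    have e1 : (fun ω => ∫ x, φ x * r ω N t x) =
        fun ω => ∫ x, φ (auxY (h N) (fun j => β N j ω) ⌊t / h N⌋₊ x) * ρ0 x := by
      funext ω
      exact ((hr ω).push N t ht φ hφ).symm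
    rw [e1]
    refine @aux_meas_int d Ω (F t) (h N) (fun j => β N j) ⌊t / h N⌋₊ (fun j hj => ?_) φ ρ0 hφ h0.meas
    refine hmeas N j t ht ?_
    have h3 := Nat.floor_le (div_nonneg ht.1 (hpos N).le)
    rw [le_div_iff₀ (hpos N)] at h3
    have h4 : (j:ℝ) ≤ (⌊t / h N⌋₊ : ℝ) := by exact_mod_cast hj.le
    exact (mul_le_mul_of_nonneg_right h4 (hpos N).le).trans h3
  have hne : Nonempty (Icc (0:ℝ) T) := ⟨⟨0, left_mem_Icc.2 hT.le⟩⟩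
  set q := TopologicalSpace.denseSeq (Icc (0:ℝ) T) with hq
  have hqd : DenseRange q := TopologicalSpace.denseRange_denseSeq _
  choose Cg hCg using fun j => (hg j).1.bounded_above_of_compact_support (hg j).2
  obtain ⟨c, hc, hae⟩ := aux_komlos μ
    (fun N i ω => ∫ x, g i.unpair.2 x * r ω N (q i.unpair.1) x) (fun i => Cg i.unpair.2)
    (fun N i => (hem N _ (q i.unpair.1).2 _ (hg i.unpair.2).1.measurable).mono (F.le _) le_rfl)
    (fun N i ω => ((hr ω).dens N _ (q i.unpair.1).2).abs_le (Eventually.of_forall (hCg i.unpair.2)))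
  have hP : ∀ᵐ ω ∂μ, ∀ t ∈ Icc (0:ℝ) T, ∀ j, ∃ l,
      Tendsto (fun k => auxS (c k) (fun N => ∫ x, g j x * r ω N t x)) atTop (𝓝 l) := by
    filter_upwards [hae] with ω hω t ht j
    refine (hr ω).allt hc (hg j).1 (hg j).2 hqd (fun i => ?_) ht
    have := hω (Nat.pair i j)
    simpa only [Nat.unpair_pair] using this
  have hex : ∀ t ω, ∃ ρ : V → ℝ, AuxDens d Λ Mm ρ ∧ (t ∈ Icc (0:ℝ) T →
      (∀ j, ∃ l, Tendsto (fun k => auxS (c k) (fun N => ∫ x, g j x * r ω N t x)) atTop (𝓝 l)) →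
      ∀ (φ : V → ℝ) (C : ℝ), AEStronglyMeasurable φ → (∀ᵐ x, |φ x| ≤ C) →
      Tendsto (fun k => auxS (c k) (fun N => ∫ x, φ x * r ω N t x)) atTop (𝓝 (∫ x, φ x * ρ x))) ∧
      (¬ (∀ j, ∃ l, Tendsto (fun k => auxS (c k) (fun N => ∫ x, g j x * r ω N t x)) atTop (𝓝 l)) → ρ = ρ0) := by
    intro t ω
    by_cases ht : t ∈ Icc (0:ℝ) T
    · by_cases hp : ∀ j, ∃ l, Tendsto (fun k => auxS (c k) (fun N => ∫ x, g j x * r ω N t x)) atTop (𝓝 l)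
      · obtain ⟨ρ, hρ, hl⟩ := (hr ω).limit hc hg hgd ht hp
        exact ⟨ρ, hρ, fun _ _ => hl, fun h => absurd hp h⟩
      · exact ⟨ρ0, (hr ω).dens0, fun _ h => absurd h hp, fun _ => rfl⟩
    · exact ⟨ρ0, (hr ω).dens0, fun h => absurd h ht, fun _ => rfl⟩
  choose ρ hρd hρl hρ0 using hex
  refine ⟨fun t x ω => ρ t ω x, ?_, ?_, ?_, ?_, ?_, ?_, ?_⟩
  · exact fun t _ => Eventually.of_forall fun ω => Eventually.of_forall fun x => (hρd t ω).nonneg x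
  · refine ⟨Λ + 1, ?_, fun t _ => Eventually.of_forall fun ω => Eventually.of_forall fun x =>
      ((hρd t ω).le x).trans (by linarith)⟩
    have := h0.Λ_nonneg
    positivity
  · exact fun t _ => Eventually.of_forall fun ω => (hρd t ω).mass
  · exact fun t _ => Eventually.of_forall fun ω => (hρd t ω).integrable_mom
  · rintro t ht φ hφ ⟨C, hC⟩
    have : Measurable[F t] fun ω => ∫ x, φ x * ρ t ω x :=
      @aux_meas_lim Ω (F t) (fun j k ω => auxS (c k) (fun N => ∫ x, g j x * r ω N t x))
        (fun j k => @aux_meas_S Ω (F t) (c k) (fun N ω => ∫ x, g j x * r ω N t x)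
          (fun N => hem N t ht _ (hg j).1.measurable))
        (fun k ω => auxS (c k) (fun N => ∫ x, φ x * r ω N t x))
        (fun k => @aux_meas_S Ω (F t) (c k) (fun N ω => ∫ x, φ x * r ω N t x)
          (fun N => hem N t ht _ hφ.measurable)) _ (∫ x, φ x * ρ0 x)
        (fun ω hω => hρl t ω ht hω φ C hφ.aestronglyMeasurable (Eventually.of_forall hC))
        (fun ω hω => by rw [hρ0 t ω hω])
    exact this.stronglyMeasurable
  · filter_upwards [hP] with ω hω φ hφ hC
    obtain ⟨C, hC⟩ := hC
    exact (hr ω).timeCont hc hg hgd (fun t _ => hρd t ω) (fun t ht => hρl t ω ht (hω t ht)) hφ hC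
  · filter_upwards [hP, hconv] with ω hω hb φ hφ hφc t ht
    exact (hr ω).weak hc hb (fun t ht => hρl t ω ht (hω t ht)) hφ hφc ht

end

/-- Proposition 2.10 / `prop.uniConti`: under (H1), (H2) and (H3), for
every initial measure `m̄₀ ∈ L^∞(ℝ^d) ∩ P₂(ℝ^d)` there exists an `(F_t)`-adapted process
`m̃ ∈ S^r(P₁(ℝ^d)) ∩ L^∞(ℝ^d × (0,T))` solving, `ℙ`-a.s. and in the sense of
distributions, the continuity equation
`∂_t m̃_t = div(m̃_t D_pH̃_t(Dũ_t(x), x))`, `m̃_0 = m̄₀`. -/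
theorem exists_solution_continuity_equation
    (T : ℝ) (hT : 0 < T)
    (μ : Measure Ω) [IsProbabilityMeasure μ] (F : Filtration ℝ mΩ)
    (W : ℝ → Ω → V) (hW : IsWienerProcess d μ F W)
    (H : ℝ → V → V → Ω → ℝ) (G : V → Ω → ℝ)
    (h1 : H1Hyp d μ F T H G) (h2 : H2Hyp d T H) (h3 : H3Hyp d μ T H)
    (u M : ℝ → V → Ω → ℝ) (hsol : IsHJSol d μ F T H G u M)
    (ρ0 : V → ℝ) (hρ0 : IsProbDensity d ρ0)
    (hρ0_bdd : ∃ C : ℝ, 0 < C ∧ ∀ x, ρ0 x ≤ C)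
    (hρ0_mom2 : Integrable (fun x : V => ‖x‖ ^ 2 * ρ0 x)) :
    ∃ ρ : ℝ → V → Ω → ℝ,
      IsContEqSol d μ F T
        (fun s x ω => gradient (fun p : V => H s p x ω)
          (gradient (fun y : V => u s y ω) x))
        ρ0 ρ := by
  obtain ⟨C, _, hC⟩ := hρ0_bdd
  exact aux_main hT h1 h2 hsol.1 (aux_dens0 hρ0 hC hρ0_mom2)
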